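/- arXiv:2109.09544 — 5 statements merged into one kernel-verified Lean document; each statement's English description precedes it below -/
import Mathlib

section
/- Let Ω be a Polish space, ν a compactly supported Borel probability measure on Ω, 𝔞 : Ω → 𝕋^d a continuous map, and μ := 𝔞_*ν the push-forward measure on 𝕋^d. Then the skew-product map 𝐟 : Ω^ℤ × 𝕋^d → Ω^ℤ × 𝕋^d, 𝐟(ω, θ) = (σω, θ + 𝔞(ω₀)), is ergodic with respect to the measure ν^ℤ × m if and only if the skew-product map f : (𝕋^d)^ℤ × 𝕋^d → (𝕋^d)^ℤ × 𝕋^d, f(β, θ) = (σβ, θ + β₀), is ergodic with respect to μ^ℤ × m. -/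
open MeasureTheory Filter Topology

noncomputable section

/-- The `d`-dimensional torus `𝕋^d = (ℝ/ℤ)^d`; `volume` on it is the Haar
probability measure `m`. -/
abbrev Td (d : ℕ) : Type := Fin d → AddCircle (1 : ℝ)

instance : IsProbabilityMeasure (volume : Measure (AddCircle (1:ℝ))) :=
  ⟨by rw [AddCircle.measure_univ]; norm_num⟩

/-- `P` is the Bernoulli product measure `ν^ι` on `ι → Ω`:
it is a probability measure giving every measurable cylinder the product mass. -/
def IsBernoulli {Ω ι : Type*} [MeasurableSpace Ω] (ν : Measure Ω)
    (P : Measure (ι → Ω)) : Prop :=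
  IsProbabilityMeasure P ∧
    ∀ (s : Finset ι) (E : ι → Set Ω), (∀ i, MeasurableSet (E i)) →
      P {ω | ∀ i ∈ s, ω i ∈ E i} = ∏ i ∈ s, ν (E i)

/-- The two-sided Bernoulli shift `(σω)_n = ω_{n+1}`. -/
def shiftZ (Ω : Type*) : (ℤ → Ω) → (ℤ → Ω) := fun ω n => ω (n + 1)

/-- A measure with the Bernoulli cylinder masses is unique. -/
theorem IsBernoulli.unique {Ω ι : Type*} [MeasurableSpace Ω] {ν : Measure Ω}
    [IsProbabilityMeasure ν] {P Q : Measure (ι → Ω)} (hP : IsBernoulli ν P)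
    (hQ : IsBernoulli ν Q) : P = Q :=
  (Measure.eq_infinitePi (fun _ => ν) fun s t ht => hP.2 s t ht).trans
    (Measure.eq_infinitePi (fun _ => ν) fun s t ht => hQ.2 s t ht).symm

/-- Reindexing a Bernoulli measure along a bijection gives the same measure. -/
theorem IsBernoulli.measurePreserving_reindex {Ω ι : Type*} [MeasurableSpace Ω] {ν : Measure Ω}
    [IsProbabilityMeasure ν] {P : Measure (ι → Ω)} (hP : IsBernoulli ν P) (e : ι ≃ ι) :
    MeasurePreserving (fun (ω : ι → Ω) i => ω (e i)) P P := by
  have hm : Measurable fun (ω : ι → Ω) i => ω (e i) := by fun_prop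
  have := hP.1
  refine ⟨hm, IsBernoulli.unique ⟨Measure.isProbabilityMeasure_map hm.aemeasurable, ?_⟩ hP⟩
  intro s E hE
  have hset : MeasurableSet {ω : ι → Ω | ∀ i ∈ s, ω i ∈ E i} :=
    MeasurableSet.pi s.countable_toSet fun i _ => hE i
  rw [Measure.map_apply hm hset]
  have := hP.2 (s.map e.toEmbedding) (fun i => E (e.symm i)) fun i => hE _
  simpa [-Finset.mem_map_equiv] using this

/-- The image of a Bernoulli measure under a coordinatewise map is Bernoulli. -/
theorem IsBernoulli.measurePreserving_comp {Ω Ω' ι : Type*} [MeasurableSpace Ω]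
    [MeasurableSpace Ω'] {ν : Measure Ω} [IsProbabilityMeasure ν] {P : Measure (ι → Ω)}
    (hP : IsBernoulli ν P) {a : Ω → Ω'} (ha : Measurable a) {Q : Measure (ι → Ω')}
    (hQ : IsBernoulli (Measure.map a ν) Q) :
    MeasurePreserving (fun (ω : ι → Ω) i => a (ω i)) P Q := by
  have hm : Measurable fun (ω : ι → Ω) i => a (ω i) := by fun_prop
  have := hP.1
  have := Measure.isProbabilityMeasure_map ha.aemeasurable (μ := ν)
  refine ⟨hm, IsBernoulli.unique ⟨Measure.isProbabilityMeasure_map hm.aemeasurable, ?_⟩ hQ⟩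
  intro s E hE
  have hset : MeasurableSet {ω : ι → Ω' | ∀ i ∈ s, ω i ∈ E i} :=
    MeasurableSet.pi s.countable_toSet fun i _ => hE i
  rw [Measure.map_apply hm hset]
  simp_rw [Measure.map_apply ha (hE _)]
  exact hP.2 s (fun i => a ⁻¹' E i) fun i => ha (hE i)

open Classical in
/-- The sequence that agrees with `ω` on `J` and with `ω'` off `J`. -/
def splice {Ω ι : Type*} (J : Set ι) (ω ω' : ι → Ω) : ι → Ω :=
  fun i => if i ∈ J then ω i else ω' i

theorem splice_of_mem {Ω ι : Type*} {J : Set ι} (ω ω' : ι → Ω) {i : ι} (hi : i ∈ J) :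
    splice J ω ω' i = ω i := if_pos hi

theorem splice_of_notMem {Ω ι : Type*} {J : Set ι} (ω ω' : ι → Ω) {i : ι} (hi : i ∉ J) :
    splice J ω ω' i = ω' i := if_neg hi

/-- Splicing two independent Bernoulli sequences gives a Bernoulli sequence. -/
theorem IsBernoulli.measurePreserving_splice {Ω ι : Type*} [MeasurableSpace Ω] {ν : Measure Ω}
    [IsProbabilityMeasure ν] {P : Measure (ι → Ω)} (hP : IsBernoulli ν P) (J : Set ι) :
    MeasurePreserving (fun p : (ι → Ω) × (ι → Ω) => splice J p.1 p.2) (P.prod P) P := by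
  classical
  have hm : Measurable fun p : (ι → Ω) × (ι → Ω) => splice J p.1 p.2 := by
    refine measurable_pi_lambda _ fun i => ?_
    by_cases hi : i ∈ J
    · simp only [splice_of_mem _ _ hi]; fun_prop
    · simp only [splice_of_notMem _ _ hi]; fun_prop
  have := hP.1
  refine ⟨hm, IsBernoulli.unique ⟨Measure.isProbabilityMeasure_map hm.aemeasurable, ?_⟩ hP⟩
  intro s E hE
  have hset : MeasurableSet {ω : ι → Ω | ∀ i ∈ s, ω i ∈ E i} :=
    MeasurableSet.pi s.countable_toSet fun i _ => hE i
  have hpre : (fun p : (ι → Ω) × (ι → Ω) => splice J p.1 p.2) ⁻¹' {ω | ∀ i ∈ s, ω i ∈ E i} =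
      {ω | ∀ i ∈ s.filter (· ∈ J), ω i ∈ E i} ×ˢ {ω | ∀ i ∈ s.filter (· ∉ J), ω i ∈ E i} := by
    ext p
    simp only [Set.mem_preimage, Set.mem_ofPred_eq, Set.mem_prod, Finset.mem_filter]
    constructor
    · intro h
      refine ⟨fun i hi => ?_, fun i hi => ?_⟩
      · simpa [splice_of_mem _ _ hi.2] using h i hi.1
      · simpa [splice_of_notMem _ _ hi.2] using h i hi.1
    · rintro ⟨h₁, h₂⟩ i hi
      by_cases hJ : i ∈ J
      · simpa [splice_of_mem _ _ hJ] using h₁ i ⟨hi, hJ⟩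
      · simpa [splice_of_notMem _ _ hJ] using h₂ i ⟨hi, hJ⟩
  rw [Measure.map_apply hm hset, hpre, Measure.prod_prod, hP.2 _ _ hE, hP.2 _ _ hE,
    Finset.prod_filter_mul_prod_filter_not]

/-- Membership of `(ω, θ)` in `C` depends on `ω` only through its coordinates in `J`. -/
def DependsOnCoords {Ω ι X : Type*} (J : Set ι) (C : Set ((ι → Ω) × X)) : Prop :=
  ∀ ⦃ω ω' : ι → Ω⦄, (∀ i ∈ J, ω i = ω' i) → ∀ θ, (ω, θ) ∈ C ↔ (ω', θ) ∈ C

theorem DependsOnCoords.mono {Ω ι X : Type*} {J J' : Set ι} {C : Set ((ι → Ω) × X)}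
    (hC : DependsOnCoords J C) (h : J ⊆ J') : DependsOnCoords J' C :=
  fun _ _ hω => hC fun i hi => hω i (h hi)

/-- Sets that depend on finitely many coordinates are dense in the measure algebra. -/
theorem measureDense_dependsOnCoords {Ω X : Type*} [MeasurableSpace Ω] [MeasurableSpace X]
    (Q : Measure ((ℤ → Ω) × X)) [IsFiniteMeasure Q] :
    Q.MeasureDense {C | MeasurableSet C ∧
      ∃ k : ℕ, DependsOnCoords (Set.Ico (-(k : ℤ)) k) C} := by
  apply Measure.MeasureDense.of_generateFrom_isSetAlgebra_finite
  · refine ⟨?_, ?_, ?_⟩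
    · exact ⟨.empty, 0, fun _ _ _ _ => Iff.rfl⟩
    · rintro s ⟨hs, k, hk⟩
      exact ⟨hs.compl, k, fun _ _ hω θ => not_congr (hk hω θ)⟩
    · rintro s t ⟨hs, k, hk⟩ ⟨ht, l, hl⟩
      refine ⟨hs.union ht, max k l, fun _ _ hω θ => or_congr (hk.mono ?_ hω θ) (hl.mono ?_ hω θ)⟩
      all_goals
        intro i hi
        simp only [Set.mem_Ico, Nat.cast_max] at hi ⊢
        omega
  · refine le_antisymm ?_ (MeasurableSpace.generateFrom_le fun s hs => hs.1)
    refine sup_le ?_ ?_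
    · refine Measurable.comap_le ?_
      refine @measurable_pi_lambda _ _ _ (MeasurableSpace.generateFrom _) _ _ fun i s hs => ?_
      have hm : Measurable fun p : (ℤ → Ω) × X => p.1 i := by fun_prop
      refine MeasurableSpace.measurableSet_generateFrom ⟨hm hs, i.natAbs + 1, ?_⟩
      intro ω ω' hω θ
      have : ω i = ω' i := hω i (by simp only [Set.mem_Ico, Nat.cast_add, Nat.cast_one]; omega)
      simp only [Set.mem_preimage, this]
    · refine Measurable.comap_le ?_
      intro s hs
      exact MeasurableSpace.measurableSet_generateFrom
        ⟨measurable_snd hs, 0, fun _ _ _ _ => Iff.rfl⟩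

open scoped symmDiff in
/-- A set that can be approximated both by sets depending only on the coordinates in `J` and by
sets depending only on those off `J` is almost everywhere independent of the sequence. -/
theorem IsBernoulli.exists_ae_eq_snd_preimage {Ω ι X : Type*} [MeasurableSpace Ω]
    [MeasurableSpace X] {ν : Measure Ω} [IsProbabilityMeasure ν] {P : Measure (ι → Ω)}
    (hP : IsBernoulli ν P) {m : Measure X} [IsProbabilityMeasure m] (J : Set ι)
    {A : Set ((ι → Ω) × X)} (hA : MeasurableSet A)
    (h₁ : ∀ ε : ℝ, 0 < ε → ∃ C, MeasurableSet C ∧ DependsOnCoords J C ∧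
      P.prod m (A ∆ C) ≤ ENNReal.ofReal ε)
    (h₂ : ∀ ε : ℝ, 0 < ε → ∃ C, MeasurableSet C ∧ DependsOnCoords Jᶜ C ∧
      P.prod m (A ∆ C) ≤ ENNReal.ofReal ε) :
    ∃ B : Set X, MeasurableSet B ∧ A =ᵐ[P.prod m] Prod.snd ⁻¹' B := by
  have := hP.1
  let Q : Measure ((ι → Ω) × (ι → Ω) × X) := P.prod (P.prod m)
  have hfst : MeasurePreserving (fun q : (ι → Ω) × (ι → Ω) × X => (q.1, q.2.2)) Q (P.prod m) :=
    (MeasurePreserving.id P).prod measurePreserving_snd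
  have hsnd : MeasurePreserving (fun q : (ι → Ω) × (ι → Ω) × X => q.2) Q (P.prod m) :=
    measurePreserving_snd
  have hspl : MeasurePreserving
      (fun q : (ι → Ω) × (ι → Ω) × X => (splice J q.1 q.2.1, q.2.2)) Q (P.prod m) :=
    ((hP.measurePreserving_splice J).prod (MeasurePreserving.id m)).comp
      (MeasurePreserving.symm _ (measurePreserving_prodAssoc P P m))
  have hnull : Q {q | ¬((q.1, q.2.2) ∈ A ↔ q.2 ∈ A)} = 0 := by
    refine le_antisymm (le_of_forall_pos_le_add fun δ hδ => ?_) bot_le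
    rw [zero_add]
    by_cases hδ' : δ = ⊤
    · simp [hδ']
    have hε : 0 < δ.toReal / 4 := by
      have := ENNReal.toReal_pos hδ.ne' hδ'
      positivity
    obtain ⟨C₁, hm₁, hd₁, hC₁⟩ := h₁ _ hε
    obtain ⟨C₂, hm₂, hd₂, hC₂⟩ := h₂ _ hε
    have hsub : {q : (ι → Ω) × (ι → Ω) × X | ¬((q.1, q.2.2) ∈ A ↔ q.2 ∈ A)} ⊆
        ((fun q => (q.1, q.2.2)) ⁻¹' (A ∆ C₁) ∪
          (fun q => (splice J q.1 q.2.1, q.2.2)) ⁻¹' (A ∆ C₁)) ∪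
        ((fun q => (splice J q.1 q.2.1, q.2.2)) ⁻¹' (A ∆ C₂) ∪ (fun q => q.2) ⁻¹' (A ∆ C₂)) := by
      rintro ⟨ω, ω', θ⟩ hq
      have e₁ : (ω, θ) ∈ C₁ ↔ (splice J ω ω', θ) ∈ C₁ :=
        hd₁ (fun i hi => (splice_of_mem ω ω' hi).symm) θ
      have e₂ : (ω', θ) ∈ C₂ ↔ (splice J ω ω', θ) ∈ C₂ :=
        hd₂ (fun i hi => (splice_of_notMem ω ω' hi).symm) θ
      simp only [Set.mem_ofPred_eq, Set.mem_union, Set.mem_preimage, Set.mem_symmDiff] at hq ⊢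
      grind
    calc Q _ ≤ _ := measure_mono hsub
      _ ≤ _ := (measure_union_le _ _).trans (add_le_add (measure_union_le _ _)
          (measure_union_le _ _))
      _ ≤ (ENNReal.ofReal (δ.toReal / 4) + ENNReal.ofReal (δ.toReal / 4)) +
          (ENNReal.ofReal (δ.toReal / 4) + ENNReal.ofReal (δ.toReal / 4)) := by
        rw [hfst.measure_preimage (hA.symmDiff hm₁).nullMeasurableSet,
          hspl.measure_preimage (hA.symmDiff hm₁).nullMeasurableSet,
          hspl.measure_preimage (hA.symmDiff hm₂).nullMeasurableSet,
          hsnd.measure_preimage (hA.symmDiff hm₂).nullMeasurableSet]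
        gcongr
      _ = δ := by
        rw [← ENNReal.ofReal_add hε.le hε.le, ← ENNReal.ofReal_add (by positivity) (by positivity)]
        ring_nf
        exact ENNReal.ofReal_toReal hδ'
  have hae : ∀ᵐ q ∂Q, (q.1, q.2.2) ∈ A ↔ q.2 ∈ A := ae_iff.2 hnull
  obtain ⟨ω, hω⟩ := (Measure.ae_ae_of_ae_prod hae).exists
  refine ⟨{θ | (ω, θ) ∈ A}, measurable_prodMk_left hA, ?_⟩
  filter_upwards [hω] with p hp
  exact propext hp.symm

/-- The skew product `(ω, θ) ↦ (σω, θ + a(ω₀))` over the Bernoulli shift. -/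
def skewShift {Ω G : Type*} [Add G] (a : Ω → G) (p : (ℤ → Ω) × G) : (ℤ → Ω) × G :=
  (shiftZ Ω p.1, p.2 + a (p.1 0))

/-- The inverse `(ω, θ) ↦ (σ⁻¹ω, θ - a(ω₋₁))` of `skewShift`. -/
def skewShiftInv {Ω G : Type*} [AddGroup G] (a : Ω → G) (p : (ℤ → Ω) × G) : (ℤ → Ω) × G :=
  (fun n => p.1 (n - 1), p.2 + -a (p.1 (-1)))

theorem skewShift_skewShiftInv {Ω G : Type*} [AddGroup G] (a : Ω → G) (p : (ℤ → Ω) × G) :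
    skewShift a (skewShiftInv a p) = p := by
  refine Prod.ext (funext fun n => ?_) ?_
  · simp [skewShift, skewShiftInv, shiftZ]
  · simp [skewShift, skewShiftInv]

theorem DependsOnCoords.skewShift_iterate {Ω G : Type*} [Add G] (a : Ω → G) {k : ℕ}
    {C : Set ((ℤ → Ω) × G)} (hC : DependsOnCoords (Set.Ici (-(k : ℤ))) C) :
    DependsOnCoords (Set.Ici 0) ((skewShift a)^[k] ⁻¹' C) := by
  induction k generalizing C with
  | zero => simpa using hC
  | succ k ih =>
    rw [Function.iterate_succ', Set.preimage_comp]
    refine ih fun ω ω' hω θ => ?_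
    have h0 : ω 0 = ω' 0 := hω 0 (by simp)
    simp only [Set.mem_preimage, skewShift, h0]
    refine hC (fun n hn => hω (n + 1) ?_) _
    simp only [Set.mem_Ici, Nat.cast_add, Nat.cast_one] at hn ⊢
    omega

theorem DependsOnCoords.skewShiftInv_iterate {Ω G : Type*} [AddGroup G] (a : Ω → G) {k : ℕ}
    {C : Set ((ℤ → Ω) × G)} (hC : DependsOnCoords (Set.Iio (k : ℤ)) C) :
    DependsOnCoords (Set.Iio 0) ((skewShiftInv a)^[k] ⁻¹' C) := by
  induction k generalizing C with
  | zero => simpa using hC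
  | succ k ih =>
    rw [Function.iterate_succ', Set.preimage_comp]
    refine ih fun ω ω' hω θ => ?_
    have h0 : ω (-1) = ω' (-1) := hω (-1) (by simp only [Set.mem_Iio]; omega)
    simp only [Set.mem_preimage, skewShiftInv, h0]
    refine hC (fun n hn => hω (n - 1) ?_) _
    simp only [Set.mem_Iio, Nat.cast_add, Nat.cast_one] at hn ⊢
    omega

section SkewShift

variable {Ω G : Type*} [MeasurableSpace Ω] [AddGroup G] [MeasurableSpace G] [MeasurableAdd₂ G]
  {ν : Measure Ω} [IsProbabilityMeasure ν] {P : Measure (ℤ → Ω)}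
  {m : Measure G} [IsProbabilityMeasure m] [m.IsAddRightInvariant] {a : Ω → G}

theorem IsBernoulli.measurePreserving_skewShift (hP : IsBernoulli ν P) (ha : Measurable a) :
    MeasurePreserving (skewShift a) (P.prod m) (P.prod m) := by
  have := hP.1
  refine (hP.measurePreserving_reindex (Equiv.addRight 1)).skew_product
    (g := fun ω θ => θ + a (ω 0)) ?_ (.of_forall fun ω => map_add_right_eq_self m _)
  simp only [Function.uncurry_def]
  fun_prop

theorem IsBernoulli.measurePreserving_skewShiftInv [MeasurableNeg G] (hP : IsBernoulli ν P)
    (ha : Measurable a) : MeasurePreserving (skewShiftInv a) (P.prod m) (P.prod m) := by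
  have := hP.1
  refine (hP.measurePreserving_reindex (Equiv.subRight 1)).skew_product
    (g := fun ω θ => θ + -a (ω (-1))) ?_ (.of_forall fun ω => map_add_right_eq_self m _)
  simp only [Function.uncurry_def]
  fun_prop

/-- Every set invariant under the skew product depends, up to null sets, only on the fibre. -/
theorem IsBernoulli.exists_ae_eq_snd_preimage_of_skewShift_invariant [MeasurableNeg G]
    (hP : IsBernoulli ν P) (ha : Measurable a) {A : Set ((ℤ → Ω) × G)} (hA : MeasurableSet A)
    (hinv : skewShift a ⁻¹' A = A) :
    ∃ B : Set G, MeasurableSet B ∧ A =ᵐ[P.prod m] Prod.snd ⁻¹' B := by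
  have := hP.1
  have hinv' : skewShiftInv a ⁻¹' A = A := by
    conv_lhs => rw [← hinv, ← Set.preimage_comp]
    exact Set.ext fun p => by simp [skewShift_skewShiftInv]
  have approx : ∀ {T : (ℤ → Ω) × G → (ℤ → Ω) × G} {J : Set ℤ},
      MeasurePreserving T (P.prod m) (P.prod m) → T ⁻¹' A = A →
      (∀ (k : ℕ) (C : Set ((ℤ → Ω) × G)), DependsOnCoords (Set.Ico (-(k : ℤ)) k) C →
        DependsOnCoords J (T^[k] ⁻¹' C)) →
      ∀ ε : ℝ, 0 < ε → ∃ C, MeasurableSet C ∧ DependsOnCoords J C ∧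
        P.prod m (symmDiff A C) ≤ ENNReal.ofReal ε := by
    intro T J hT hTA hJ ε hε
    obtain ⟨C, ⟨hC, k, hk⟩, hAC⟩ :=
      (measureDense_dependsOnCoords (P.prod m)).approx A hA (measure_ne_top _ _) ε hε
    refine ⟨T^[k] ⁻¹' C, (hT.iterate k).measurable hC, hJ k C hk, ?_⟩
    have hpre : symmDiff A (T^[k] ⁻¹' C) = T^[k] ⁻¹' symmDiff A C := by
      rw [Set.preimage_symmDiff, Function.IsFixedPt.preimage_iterate hTA k]
    rw [hpre, (hT.iterate k).measure_preimage (hA.symmDiff hC).nullMeasurableSet]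
    exact hAC.le
  exact hP.exists_ae_eq_snd_preimage (Set.Ici 0) hA
    (approx (hP.measurePreserving_skewShift ha) hinv fun k C hC =>
      (hC.mono fun _ hi => hi.1).skewShift_iterate a)
    (approx (hP.measurePreserving_skewShiftInv ha) hinv' fun k C hC =>
      ((hC.mono fun _ hi => hi.2).skewShiftInv_iterate a).mono fun _ hi => by simpa using hi)

end SkewShift

/-- Let `Ω` be a Polish space, `ν` a compactly supported Borel
probability measure on `Ω`, `𝔞 : Ω → 𝕋^d` continuous, and `μ = 𝔞_*ν`. Then the
skew-product `𝐟(ω, θ) = (σω, θ + 𝔞(ω₀))` on `Ω^ℤ × 𝕋^d` is ergodic w.r.t.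
`ν^ℤ × m` iff the skew-product `f(β, θ) = (σβ, θ + β₀)` on `(𝕋^d)^ℤ × 𝕋^d`
is ergodic w.r.t. `μ^ℤ × m`. -/
theorem ergodic_mixed_iff_ergodic_factor
    {Ω : Type*} [TopologicalSpace Ω] [PolishSpace Ω]
    [MeasurableSpace Ω] [BorelSpace Ω] {d : ℕ}
    (ν : Measure Ω) [IsProbabilityMeasure ν]
    (hν : ∃ K : Set Ω, IsCompact K ∧ ν Kᶜ = 0)
    (𝔞 : Ω → Td d) (h𝔞 : Continuous 𝔞)
    (νZ : Measure (ℤ → Ω)) (hνZ : IsBernoulli ν νZ)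
    (μZ : Measure (ℤ → Td d)) (hμZ : IsBernoulli (Measure.map 𝔞 ν) μZ) :
    Ergodic (fun p : (ℤ → Ω) × Td d => (shiftZ Ω p.1, p.2 + 𝔞 (p.1 0)))
        (νZ.prod volume) ↔
      Ergodic (fun p : (ℤ → Td d) × Td d => (shiftZ (Td d) p.1, p.2 + p.1 0))
        (μZ.prod volume) := by
  have hmeas : Measurable 𝔞 := h𝔞.measurable
  have := Measure.isProbabilityMeasure_map hmeas.aemeasurable (μ := ν)
  have := hνZ.1
  have := hμZ.1
  have hπ : MeasurePreserving (Prod.map (fun (ω : ℤ → Ω) n => 𝔞 (ω n)) (id : Td d → Td d))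
      (νZ.prod volume) (μZ.prod volume) :=
    (hνZ.measurePreserving_comp hmeas hμZ).prod (MeasurePreserving.id _)
  have hf : MeasurePreserving (skewShift (id : Td d → Td d)) (μZ.prod volume)
      (μZ.prod volume) := hμZ.measurePreserving_skewShift measurable_id
  have hF : MeasurePreserving (skewShift 𝔞) (νZ.prod volume) (νZ.prod volume) :=
    hνZ.measurePreserving_skewShift hmeas
  change Ergodic (skewShift 𝔞) _ ↔ Ergodic (skewShift (id : Td d → Td d)) _
  refine ⟨fun h => hπ.ergodic_of_ergodic_semiconj h hf.measurable fun _ => rfl,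
    fun h => ⟨hF, ⟨fun A hA hinv => ?_⟩⟩⟩
  obtain ⟨B, hB, hAB⟩ :=
    hνZ.exists_ae_eq_snd_preimage_of_skewShift_invariant (m := volume) hmeas hA hinv
  have hB' : MeasurableSet (Prod.snd ⁻¹' B : Set ((ℤ → Td d) × Td d)) := measurable_snd hB
  have hBinv : skewShift (id : Td d → Td d) ⁻¹' (Prod.snd ⁻¹' B) =ᵐ[μZ.prod volume]
      Prod.snd ⁻¹' B := by
    have hup : skewShift 𝔞 ⁻¹' (Prod.snd ⁻¹' B) =ᵐ[νZ.prod volume] Prod.snd ⁻¹' B := by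
      have := hF.quasiMeasurePreserving.preimage_ae_eq hAB
      rw [hinv] at this
      exact this.symm.trans hAB
    rw [← measure_symmDiff_eq_zero_iff] at hup ⊢
    rw [← hπ.measure_preimage ((hf.measurable hB').symmDiff hB').nullMeasurableSet]
    exact hup
  have hconst := h.quasiErgodic.aeconst_set₀ hB'.nullMeasurableSet hBinv
  exact ((hπ.aeconst_preimage hB'.nullMeasurableSet).2 hconst).congr hAB.symm
end
end

section
/- Let μ be a Borel probability measure on 𝕋^d. The one-sided skew-product f(β, θ) = (σβ, θ + β₀) on (𝕋^d)^ℕ × 𝕋^d is ergodic with respect to μ^ℕ × m if and only if every m-stationary observable φ ∈ L^∞(𝕋^d, m), i.e. every essentially bounded measurable φ satisfying (Q_μ φ)(θ) = φ(θ) for m-almost every θ, is constant m-almost everywhere. -/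
open MeasureTheory Filter Topology

noncomputable section

/-- The Markov operator `(Q_μ φ)(θ) = ∫ φ(θ + α) dμ(α)`. -/
def Qop {d : ℕ} (μ : Measure (Td d)) (φ : Td d → ℝ) : Td d → ℝ :=
  fun θ => ∫ α, φ (θ + α) ∂μ

/-- A measure satisfying the Bernoulli cylinder identities is the infinite product measure. -/
theorem IsBernoulli.eq_infinitePi {Ω ι : Type*} [MeasurableSpace Ω] {ν : Measure Ω}
    [IsProbabilityMeasure ν] {P : Measure (ι → Ω)} (h : IsBernoulli ν P) :
    P = Measure.infinitePi fun _ : ι => ν :=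
  Measure.eq_infinitePi _ fun s t ht => h.2 s t ht

/-- Prepend a letter to a sequence. -/
def seqCons {X : Type*} (a : X) (b : ℕ → X) : ℕ → X
  | 0 => a
  | n + 1 => b n

theorem measurable_seqCons {X : Type*} [MeasurableSpace X] :
    Measurable fun p : X × (ℕ → X) => seqCons p.1 p.2 := by
  refine measurable_pi_iff.2 fun n => ?_
  cases n with
  | zero => exact measurable_fst
  | succ n => exact (measurable_pi_apply n).comp measurable_snd

/-- A box over a finite set of coordinates is a box over an initial segment, filled up by full
factors. -/
theorem exists_initial_box {X : Type*} [MeasurableSpace X] (s : Finset ℕ) (t : ℕ → Set X)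
    (ht : ∀ i, MeasurableSet (t i)) :
    ∃ (n : ℕ) (u : ℕ → Set X), (∀ i, MeasurableSet (u i)) ∧
      (s : Set ℕ).pi t = {b | ∀ i < n + 1, b i ∈ u i} := by
  classical
  refine ⟨s.sup id, fun i => if i ∈ s then t i else Set.univ, fun i => ?_, ?_⟩
  · dsimp only
    split_ifs
    exacts [ht i, MeasurableSet.univ]
  · ext b
    simp only [Set.mem_pi, Finset.mem_coe, Set.mem_ofPred_eq]
    refine ⟨fun h i _ => ?_, fun h i hi => ?_⟩
    · split_ifs with hi
      exacts [h i hi, Set.mem_univ _]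
    · have := h i (Nat.lt_succ_of_le (Finset.le_sup (f := id) hi))
      rwa [if_pos hi] at this

theorem measurableSet_initial_box {X : Type*} [MeasurableSpace X] (n : ℕ) {u : ℕ → Set X}
    (hu : ∀ i, MeasurableSet (u i)) : MeasurableSet {b : ℕ → X | ∀ i < n, b i ∈ u i} := by
  have : {b : ℕ → X | ∀ i < n, b i ∈ u i} = ⋂ i, ⋂ _ : i < n, (fun b => b i) ⁻¹' u i := by
    ext b; simp
  rw [this]
  exact MeasurableSet.iInter fun i => MeasurableSet.iInter fun _ => measurable_pi_apply i (hu i)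

theorem infinitePi_initial_box {X : Type*} [MeasurableSpace X] (μ : Measure X)
    [IsProbabilityMeasure μ] (n : ℕ) {u : ℕ → Set X} (hu : ∀ i, MeasurableSet (u i)) :
    Measure.infinitePi (fun _ : ℕ => μ) {b | ∀ i < n, b i ∈ u i} =
      ∏ i ∈ Finset.range n, μ (u i) := by
  rw [← Measure.infinitePi_pi (μ := fun _ : ℕ => μ) (s := Finset.range n) fun i _ => hu i]
  congr 1
  ext b
  simp

theorem forall_seqCons_mem_iff {X : Type*} (n : ℕ) (u : ℕ → Set X) (a : X) (b : ℕ → X) :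
    (∀ i < n + 1, seqCons a b i ∈ u i) ↔ a ∈ u 0 ∧ ∀ i < n, b i ∈ u (i + 1) := by
  refine ⟨fun h => ⟨h 0 n.succ_pos, fun i hi => h (i + 1) (Nat.succ_lt_succ hi)⟩, ?_⟩
  rintro ⟨h0, h⟩ i hi
  cases i with
  | zero => exact h0
  | succ i => exact h i (Nat.lt_of_succ_lt_succ hi)

/-- Prepending an independent letter preserves the Bernoulli measure. -/
theorem measurePreserving_seqCons {X : Type*} [MeasurableSpace X] (μ : Measure X)
    [IsProbabilityMeasure μ] :
    MeasurePreserving (fun p : X × (ℕ → X) => seqCons p.1 p.2)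
      (μ.prod (Measure.infinitePi fun _ : ℕ => μ)) (Measure.infinitePi fun _ : ℕ => μ) := by
  refine ⟨measurable_seqCons, Measure.eq_infinitePi _ fun s t ht => ?_⟩
  rw [← Measure.infinitePi_pi (μ := fun _ : ℕ => μ) fun i _ => ht i]
  obtain ⟨n, u, hu, h⟩ := exists_initial_box s t ht
  rw [h, Measure.map_apply measurable_seqCons (measurableSet_initial_box _ hu),
    infinitePi_initial_box μ _ hu, Finset.prod_range_succ', mul_comm,
    ← infinitePi_initial_box μ n fun i => hu (i + 1), ← Measure.prod_prod]
  congr 1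
  ext p
  exact forall_seqCons_mem_iff n u p.1 p.2

theorem infinitePi_apply_eq_lintegral_seqCons {X : Type*} [MeasurableSpace X] (μ : Measure X)
    [IsProbabilityMeasure μ] {G : Set (ℕ → X)} (hG : MeasurableSet G) :
    Measure.infinitePi (fun _ : ℕ => μ) G =
      ∫⁻ a, Measure.infinitePi (fun _ : ℕ => μ) {b | seqCons a b ∈ G} ∂μ := by
  rw [← (measurePreserving_seqCons μ).measure_preimage hG.nullMeasurableSet,
    Measure.prod_apply (measurable_seqCons hG)]
  rfl

theorem measurePreserving_seqShift {X : Type*} [MeasurableSpace X] (μ : Measure X)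
    [IsProbabilityMeasure μ] :
    MeasurePreserving (fun (b : ℕ → X) n => b (n + 1))
      (Measure.infinitePi fun _ : ℕ => μ) (Measure.infinitePi fun _ : ℕ => μ) := by
  have hm : Measurable fun (b : ℕ → X) n => b (n + 1) :=
    measurable_pi_iff.2 fun n => measurable_pi_apply (n + 1)
  refine ⟨hm, ?_⟩
  conv_lhs => rw [← (measurePreserving_seqCons μ).map_eq]
  rw [Measure.map_map hm measurable_seqCons]
  exact (measurePreserving_snd (μ := μ) (ν := Measure.infinitePi fun _ : ℕ => μ)).map_eq

theorem seqCons_mem_iff_of_invariant {X : Type*} [Add X] {A : Set ((ℕ → X) × X)}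
    (hinv : (fun p : (ℕ → X) × X =>
      ((fun n => p.1 (n + 1) : ℕ → X), p.2 + p.1 0)) ⁻¹' A = A) (a : X) (b : ℕ → X) (x : X) :
    (seqCons a b, x) ∈ A ↔ (b, x + a) ∈ A := by
  conv_lhs => rw [← hinv]
  rfl

section Translation

variable {X : Type*} [MeasurableSpace X] [AddGroup X] [MeasurableAdd₂ X]
  (m μ : Measure X) [IsProbabilityMeasure m] [IsProbabilityMeasure μ] [m.IsAddRightInvariant]

/-- The sum of an `m`-distributed and an independent point is `m`-distributed. -/
theorem measurePreserving_add_of_isAddRightInvariant :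
    MeasurePreserving (fun p : X × X => p.1 + p.2) (m.prod μ) m := by
  have h : MeasurePreserving (fun p : X × X => (p.1, p.2 + p.1)) (μ.prod m) (μ.prod m) :=
    (MeasurePreserving.id μ).skew_product (measurable_snd.add measurable_fst)
      (Eventually.of_forall fun a => map_add_right_eq_self m a)
  exact (measurePreserving_snd.comp h).comp Measure.measurePreserving_swap

theorem measurePreserving_skewProduct :
    MeasurePreserving (fun p : (ℕ → X) × X => ((fun n => p.1 (n + 1) : ℕ → X), p.2 + p.1 0))
      ((Measure.infinitePi fun _ : ℕ => μ).prod m)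
      ((Measure.infinitePi fun _ : ℕ => μ).prod m) :=
  (measurePreserving_seqShift μ).skew_product (g := fun b x => x + b 0)
    (measurable_snd.add ((measurable_pi_apply 0).comp measurable_fst))
    (Eventually.of_forall fun b => map_add_right_eq_self m (b 0))

/-- A bounded function equal a.e. to its average over `μ`-translates is a.e. invariant under
`μ`-almost every translation. -/
theorem ae_translate_eq_of_stationary {φ : X → ℝ} (hφ : Measurable φ) {C : ℝ}
    (hC : ∀ x, |φ x| ≤ C) (hs : ∀ᵐ x ∂m, ∫ a, φ (x + a) ∂μ = φ x) :
    ∀ᵐ p ∂m.prod μ, φ (p.1 + p.2) = φ p.1 := by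
  have hadd := measurePreserving_add_of_isAddRightInvariant m μ
  have hbd {Y : Type _} [MeasurableSpace Y] (ν : Measure Y) [IsProbabilityMeasure ν]
      {f g : Y → X} (hf : Measurable f) (hg : Measurable g) :
      Integrable (fun y => φ (f y) * φ (g y)) ν := by
    refine Integrable.of_bound ((hφ.comp hf).mul (hφ.comp hg)).aestronglyMeasurable (C * C)
      (Eventually.of_forall fun y => ?_)
    rw [Real.norm_eq_abs, abs_mul]
    exact mul_le_mul (hC _) (hC _) (abs_nonneg _) ((abs_nonneg _).trans (hC (f y)))
  have i1 := hbd (m.prod μ) hadd.measurable hadd.measurable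
  have i2 := hbd (m.prod μ) measurable_fst hadd.measurable
  have i3 := hbd (m.prod μ) measurable_fst measurable_fst
  have e1 : ∫ p, φ (p.1 + p.2) * φ (p.1 + p.2) ∂m.prod μ = ∫ x, φ x * φ x ∂m := by
    conv_rhs => rw [← hadd.map_eq]
    exact (integral_map (f := fun x => φ x * φ x) hadd.aemeasurable
      (hφ.mul hφ).aestronglyMeasurable).symm
  have e2 : ∫ p, φ p.1 * φ (p.1 + p.2) ∂m.prod μ = ∫ x, φ x * φ x ∂m := by
    rw [integral_prod _ i2]
    refine integral_congr_ae (hs.mono fun x hx => ?_)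
    dsimp only
    rw [integral_const_mul, hx]
  have e3 : ∫ p, φ p.1 * φ p.1 ∂m.prod μ = ∫ x, φ x * φ x ∂m := by
    rw [integral_prod _ i3]
    simp
  have hsq : (fun p : X × X => (φ (p.1 + p.2) - φ p.1) ^ 2) =
      fun p => φ (p.1 + p.2) * φ (p.1 + p.2) - 2 * (φ p.1 * φ (p.1 + p.2)) + φ p.1 * φ p.1 := by
    ext p; ring
  have h0 : ∫ p, (φ (p.1 + p.2) - φ p.1) ^ 2 ∂m.prod μ = 0 := by
    have h12 : ∫ p, (φ (p.1 + p.2) * φ (p.1 + p.2) - 2 * (φ p.1 * φ (p.1 + p.2))) ∂m.prod μ =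
        -∫ x, φ x * φ x ∂m := by
      rw [integral_sub i1 (i2.const_mul 2), integral_const_mul, e1, e2]
      ring
    have hadd' := integral_add (i1.sub (i2.const_mul 2)) i3
    simp only [Pi.sub_apply] at hadd'
    rw [hsq, hadd', h12, e3, neg_add_cancel]
  have hi : Integrable (fun p : X × X => (φ (p.1 + p.2) - φ p.1) ^ 2) (m.prod μ) := by
    rw [hsq]
    exact (i1.sub (i2.const_mul 2)).add i3
  filter_upwards [(integral_eq_zero_iff_of_nonneg (fun p => sq_nonneg _) hi).1 h0] with p hp
  exact sub_eq_zero.1 (pow_eq_zero_iff two_ne_zero |>.1 hp)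

theorem stationary_const_of_ergodic
    (he : Ergodic (fun p : (ℕ → X) × X => ((fun n => p.1 (n + 1) : ℕ → X), p.2 + p.1 0))
      ((Measure.infinitePi fun _ : ℕ => μ).prod m))
    {φ : X → ℝ} (hφ : Measurable φ) {C : ℝ}
    (hC : ∀ x, |φ x| ≤ C) (hs : ∀ᵐ x ∂m, ∫ a, φ (x + a) ∂μ = φ x) :
    ∃ c : ℝ, ∀ᵐ x ∂m, φ x = c := by
  have hmp : MeasurePreserving (fun p : (ℕ → X) × X => (p.2, p.1 0))
      ((Measure.infinitePi fun _ : ℕ => μ).prod m) (m.prod μ) :=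
    ((MeasurePreserving.id m).prod (measurePreserving_eval_infinitePi (fun _ : ℕ => μ) 0)).comp
      Measure.measurePreserving_swap
  obtain ⟨c, hc⟩ := he.ae_eq_const_of_ae_eq_comp_ae (g := fun p : (ℕ → X) × X => φ p.2)
    (hφ.comp measurable_snd).aestronglyMeasurable
    (hmp.quasiMeasurePreserving.ae (ae_translate_eq_of_stationary m μ hφ hC hs))
  refine ⟨c, ?_⟩
  rw [← (measurePreserving_snd (μ := Measure.infinitePi fun _ : ℕ => μ) (ν := m)).map_eq]
  exact (ae_map_iff measurable_snd.aemeasurable (hφ (measurableSet_singleton c))).2 hc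

section Invariant

variable {A : Set ((ℕ → X) × X)} (hA : MeasurableSet A)
  (hinv : (fun p : (ℕ → X) × X => ((fun n => p.1 (n + 1) : ℕ → X), p.2 + p.1 0)) ⁻¹' A = A)
include hinv hA

omit [MeasurableAdd₂ X] in
/-- The conditional mass of an invariant set given the fibre coordinate is stationary. -/
theorem fibre_measure_eq_lintegral_translate (x : X) :
    Measure.infinitePi (fun _ : ℕ => μ) {b | (b, x) ∈ A} =
      ∫⁻ a, Measure.infinitePi (fun _ : ℕ => μ) {b | (b, x + a) ∈ A} ∂μ := by
  refine (infinitePi_apply_eq_lintegral_seqCons μ (measurable_prodMk_right hA)).trans ?_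
  simp only [Set.mem_preimage, seqCons_mem_iff_of_invariant hinv]

/-- If the conditional mass of an invariant set given the fibre coordinate is constant, then it
stays so on initial boxes. -/
theorem ae_fibre_measure_box_inter {c : ENNReal}
    (hc : ∀ᵐ x ∂m, Measure.infinitePi (fun _ : ℕ => μ) {b | (b, x) ∈ A} = c) (n : ℕ) :
    ∀ u : ℕ → Set X, (∀ i, MeasurableSet (u i)) →
      ∀ᵐ x ∂m, Measure.infinitePi (fun _ : ℕ => μ)
        {b | (∀ i < n, b i ∈ u i) ∧ (b, x) ∈ A} = c * ∏ i ∈ Finset.range n, μ (u i) := by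
  induction n with
  | zero => intro u _; simpa using hc
  | succ n ih =>
    intro u hu
    have h := Measure.ae_ae_of_ae_prod
      ((measurePreserving_add_of_isAddRightInvariant m μ).quasiMeasurePreserving.ae
        (ih (fun i => u (i + 1)) fun i => hu (i + 1)))
    filter_upwards [h] with x hx
    refine (infinitePi_apply_eq_lintegral_seqCons μ
      ((measurableSet_initial_box (n + 1) hu).inter (measurable_prodMk_right hA))).trans ?_
    have : ∀ᵐ a ∂μ, Measure.infinitePi (fun _ : ℕ => μ)
        {b | seqCons a b ∈ {b | ∀ i < n + 1, b i ∈ u i} ∩ (fun b => (b, x)) ⁻¹' A} =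
        (u 0).indicator (fun _ => c * ∏ i ∈ Finset.range n, μ (u (i + 1))) a := by
      filter_upwards [hx] with a ha
      simp only [Set.mem_inter_iff, Set.mem_ofPred_eq, Set.mem_preimage,
        forall_seqCons_mem_iff, seqCons_mem_iff_of_invariant hinv]
      by_cases h0 : a ∈ u 0
      · simpa [h0] using ha
      · simp [h0]
    rw [lintegral_congr_ae this, lintegral_indicator_const (hu 0), Finset.prod_range_succ',
      mul_assoc]

/-- An invariant set with constant conditional mass given the fibre coordinate is trivial. -/
theorem eventuallyConst_of_ae_fibre_measure_const {c : ENNReal} (hct : c ≠ ⊤)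
    (hc : ∀ᵐ x ∂m, Measure.infinitePi (fun _ : ℕ => μ) {b | (b, x) ∈ A} = c) :
    EventuallyConst A (ae ((Measure.infinitePi fun _ : ℕ => μ).prod m)) := by
  set N := Measure.infinitePi fun _ : ℕ => μ with hN
  have hfin : IsFiniteMeasure (c • N) := Measure.smul_finite N hct
  have key : (c • N).prod m = (N.prod m).restrict A := by
    have huniv : Set.univ ∈ squareCylinders fun _ : ℕ => {s : Set X | MeasurableSet s} :=
      ⟨∅, fun _ => Set.univ, by simp, by simp⟩
    refine Measure.prod_eq_generateFrom (C := squareCylinders fun _ : ℕ => {s | MeasurableSet s})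
      (D := {s | MeasurableSet s}) generateFrom_squareCylinders
      MeasurableSpace.generateFrom_measurableSet
      (isPiSystem_squareCylinders (fun _ => MeasurableSpace.isPiSystem_measurableSet)
        fun _ => MeasurableSet.univ)
      MeasurableSpace.isPiSystem_measurableSet
      ⟨fun _ => Set.univ, fun _ => huniv, fun _ => measure_lt_top _ _, Set.iUnion_const _⟩
      m.toFiniteSpanningSetsIn ?_
    rintro _ ⟨s, t, ht, rfl⟩ B hB
    obtain ⟨n, u, hu, hbox⟩ := exists_initial_box s t fun i => ht i (Set.mem_univ i)
    have hboxm := measurableSet_initial_box (n + 1) hu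
    rw [hbox, Measure.restrict_apply (hboxm.prod hB),
      Measure.prod_apply_symm ((hboxm.prod hB).inter hA), Measure.smul_apply, smul_eq_mul, hN,
      infinitePi_initial_box μ (n + 1) hu, ← lintegral_indicator_const hB]
    refine lintegral_congr_ae ?_
    filter_upwards [ae_fibre_measure_box_inter m μ hA hinv hc (n + 1) u hu] with x hx
    by_cases hxB : x ∈ B
    · rw [Set.indicator_of_mem hxB, ← hx]
      congr 1
      ext b
      simp [hxB]
    · rw [Set.indicator_of_notMem hxB]
      have : (fun b : ℕ → X => (b, x)) ⁻¹' ({b | ∀ i < n + 1, b i ∈ u i} ×ˢ B ∩ A) = ∅ := by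
        ext b
        simp [hxB]
      rw [this, measure_empty]
  rw [Measure.prod_smul_left] at key
  rw [eventuallyConst_set']
  have h1 : c * N.prod m Aᶜ = 0 := by
    have := congrArg (fun ν => ν Aᶜ) key
    simpa [Measure.restrict_apply hA.compl] using this
  rcases mul_eq_zero.1 h1 with h | h
  · left
    rw [h, zero_smul] at key
    exact ae_eq_empty.2 (Measure.restrict_eq_zero.1 key.symm)
  · right
    exact ae_eq_univ.2 h

end Invariant

theorem ergodic_of_stationary_const
    (h : ∀ φ : X → ℝ, Measurable φ → (∃ C : ℝ, ∀ x, |φ x| ≤ C) →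
      (∀ᵐ x ∂m, ∫ a, φ (x + a) ∂μ = φ x) → ∃ c : ℝ, ∀ᵐ x ∂m, φ x = c) :
    Ergodic (fun p : (ℕ → X) × X => ((fun n => p.1 (n + 1) : ℕ → X), p.2 + p.1 0))
      ((Measure.infinitePi fun _ : ℕ => μ).prod m) := by
  refine ⟨measurePreserving_skewProduct m μ, ⟨fun A hA hinv => ?_⟩⟩
  have hm : Measurable fun x => Measure.infinitePi (fun _ : ℕ => μ) {b | (b, x) ∈ A} :=
    measurable_measure_prodMk_right hA
  obtain ⟨c, hc⟩ := h (fun x => (Measure.infinitePi (fun _ : ℕ => μ) {b | (b, x) ∈ A}).toReal)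
    hm.ennreal_toReal ⟨1, fun x => by
      rw [abs_of_nonneg ENNReal.toReal_nonneg]
      exact ENNReal.toReal_le_of_le_ofReal zero_le_one (by simpa using prob_le_one)⟩
    (Eventually.of_forall fun x => by
      rw [fibre_measure_eq_lintegral_translate μ hA hinv x]
      exact integral_toReal (hm.comp (measurable_const_add x)).aemeasurable
        (Eventually.of_forall fun a => measure_lt_top _ _))
  refine eventuallyConst_of_ae_fibre_measure_const m μ hA hinv (c := ENNReal.ofReal c)
    ENNReal.ofReal_ne_top (hc.mono fun x hx => ?_)
  rw [← hx, ENNReal.ofReal_toReal (measure_ne_top _ _)]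

end Translation

/-- The one-sided skew-product `f(β, θ) = (σβ, θ + β₀)` on
`(𝕋^d)^ℕ × 𝕋^d` is ergodic w.r.t. `μ^ℕ × m` iff every bounded measurable
`m`-stationary observable (`Q_μ φ = φ` `m`-a.e.) is constant `m`-a.e. -/
theorem ergodic_one_sided_iff_stationary_const {d : ℕ}
    (μ : Measure (Td d)) [IsProbabilityMeasure μ]
    (μN : Measure (ℕ → Td d)) (hμN : IsBernoulli μ μN) :
    Ergodic (fun p : (ℕ → Td d) × Td d => (fun n => p.1 (n + 1), p.2 + p.1 0))
        (μN.prod volume) ↔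
      ∀ φ : Td d → ℝ, Measurable φ → (∃ C : ℝ, ∀ θ, |φ θ| ≤ C) →
        (∀ᵐ θ ∂(volume : Measure (Td d)), Qop μ φ θ = φ θ) →
        ∃ c : ℝ, ∀ᵐ θ ∂(volume : Measure (Td d)), φ θ = c := by
  obtain rfl := hμN.eq_infinitePi
  refine ⟨fun he φ hφ ⟨C, hC⟩ hs => stationary_const_of_ergodic volume μ he hφ hC hs, fun h => ?_⟩
  exact ergodic_of_stationary_const volume μ h
end
end

section
/- Let μ be a Borel probability measure on 𝕋^d. If the one-sided skew-product f(β, θ) = (σβ, θ + β₀) on (𝕋^d)^ℕ × 𝕋^d is ergodic with respect to μ^ℕ × m, then for every θ ∈ 𝕋^d and every continuous function φ : 𝕋^d → ℝ, the Cesàro averages (1/n) ∑_{j=0}^{n−1} (Q_μ^j φ)(θ) converge to ∫_{𝕋^d} φ dm as n → ∞. -/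
open MeasureTheory Filter Topology

noncomputable section

/-- A uniformly bounded sequence of linear functionals that tends to zero pointwise on a set
with dense span tends to zero pointwise everywhere. -/
theorem tendsto_zero_of_dense_span {E : Type*} [NormedAddCommGroup E] [NormedSpace ℂ E]
    (L : ℕ → E →ₗ[ℂ] ℂ) (C : ℝ) (hL : ∀ n x, ‖L n x‖ ≤ C * ‖x‖) (S : Set E)
    (hS : (Submodule.span ℂ S).topologicalClosure = ⊤)
    (hlim : ∀ x ∈ S, Tendsto (fun n => L n x) atTop (𝓝 0)) (x : E) :
    Tendsto (fun n => L n x) atTop (𝓝 0) := by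
  have hspan : ∀ y ∈ Submodule.span ℂ S, Tendsto (fun n => L n y) atTop (𝓝 0) := by
    intro y hy
    induction hy using Submodule.span_induction with
    | mem y hy => exact hlim y hy
    | zero => simp
    | add y z _ _ hy hz => simpa using hy.add hz
    | smul a y _ hy => simpa using hy.const_mul a
  have hx : x ∈ closure (Submodule.span ℂ S : Set E) := by
    rw [← Submodule.topologicalClosure_coe, hS]
    trivial
  rw [Metric.tendsto_atTop]
  intro ε hε
  obtain ⟨y, hy, hxy⟩ := Metric.mem_closure_iff.1 hx (ε / (2 * (|C| + 1))) (by positivity)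
  obtain ⟨N, hN⟩ := Metric.tendsto_atTop.1 (hspan y hy) (ε / 2) (by positivity)
  refine ⟨N, fun n hn => ?_⟩
  have hy' : ‖L n y‖ < ε / 2 := by simpa using hN n hn
  rw [dist_eq_norm] at hxy
  rw [lt_div_iff₀ (by positivity)] at hxy
  have hxy' : ‖L n (x - y)‖ ≤ |C| * ‖x - y‖ :=
    (hL n _).trans (mul_le_mul_of_nonneg_right (le_abs_self C) (norm_nonneg _))
  have hsum : ‖L n x‖ ≤ ‖L n (x - y)‖ + ‖L n y‖ := by
    simpa using norm_add_le (L n (x - y)) (L n y)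
  rw [dist_zero_right]
  nlinarith [norm_nonneg (x - y)]

/-- Cesàro averages of the powers of a complex number `c ≠ 1` in the closed unit disc
tend to zero. -/
theorem tendsto_cesaro_pow_zero {c : ℂ} (hc : ‖c‖ ≤ 1) (hc1 : c ≠ 1) :
    Tendsto (fun n : ℕ => (1 / (n : ℂ)) * ∑ j ∈ Finset.range n, c ^ j) atTop (𝓝 0) := by
  refine squeeze_zero_norm (a := fun n : ℕ => (2 / ‖c - 1‖) / (n : ℝ)) (fun n => ?_)
    (tendsto_const_div_atTop_nhds_zero_nat _)
  rw [geom_sum_eq hc1, norm_mul, norm_div, norm_div, norm_one, Complex.norm_natCast,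
    div_mul_eq_mul_div, one_mul]
  gcongr
  calc ‖c ^ n - 1‖ ≤ ‖c ^ n‖ + ‖(1 : ℂ)‖ := norm_sub_le _ _
    _ ≤ 1 + 1 := by
      rw [norm_pow, norm_one]
      gcongr
      exact pow_le_one₀ (norm_nonneg _) hc
    _ = 2 := by norm_num

/-- Integration against a finite measure as a linear functional on continuous functions. -/
def integralFunctional {X : Type*} [TopologicalSpace X] [CompactSpace X] [MeasurableSpace X]
    [OpensMeasurableSpace X] (ν : Measure X) [IsFiniteMeasure ν] :
    C(X, ℂ) →ₗ[ℂ] ℂ where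
  toFun F := ∫ x, F x ∂ν
  map_add' F G := integral_add
    (F.continuous.integrable_of_hasCompactSupport (HasCompactSupport.of_compactSpace _))
    (G.continuous.integrable_of_hasCompactSupport (HasCompactSupport.of_compactSpace _))
  map_smul' a _ := integral_const_mul a _

theorem norm_integralFunctional_le {X : Type*} [TopologicalSpace X] [CompactSpace X]
    [MeasurableSpace X] [OpensMeasurableSpace X] (ν : Measure X) [IsProbabilityMeasure ν]
    (F : C(X, ℂ)) : ‖integralFunctional ν F‖ ≤ ‖F‖ := by
  simpa [integralFunctional] using
    norm_integral_le_of_norm_le_const (μ := ν) (.of_forall F.norm_coe_le_norm)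

/-- The `j`-fold convolution power of a measure. -/
def convPow {G : Type*} [AddMonoid G] [MeasurableSpace G] (μ : Measure G) : ℕ → Measure G
  | 0 => Measure.dirac 0
  | j + 1 => μ.conv (convPow μ j)

instance {G : Type*} [AddMonoid G] [MeasurableSpace G] [MeasurableAdd₂ G] (μ : Measure G)
    [IsProbabilityMeasure μ] (j : ℕ) : IsProbabilityMeasure (convPow μ j) := by
  induction j with
  | zero => exact Measure.dirac.isProbabilityMeasure
  | succ j ih => exact inferInstanceAs (IsProbabilityMeasure (μ.conv (convPow μ j)))

/-- Iterates of the Markov operator are integrals against convolution powers. -/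
theorem Qop_iterate_eq {d : ℕ} (μ : Measure (Td d)) [IsProbabilityMeasure μ]
    (φ : Td d → ℝ) (hφ : Continuous φ) (j : ℕ) (θ : Td d) :
    (Qop μ)^[j] φ θ = ∫ β, φ (θ + β) ∂(convPow μ j) := by
  induction j generalizing θ with
  | zero => simp [convPow]
  | succ j ih =>
    have hint : Integrable (fun β => φ (θ + β)) (μ.conv (convPow μ j)) :=
      Continuous.integrable_of_hasCompactSupport (by fun_prop)
        (HasCompactSupport.of_compactSpace _)
    rw [Function.iterate_succ_apply', convPow, integral_conv hint]
    simp only [Qop, ih, add_assoc]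

namespace UnitAddTorus

variable {ι : Type*} [Fintype ι]

theorem mFourier_apply_add (n : ι → ℤ) (x y : UnitAddTorus ι) :
    mFourier n (x + y) = mFourier n x * mFourier n y := by
  simp [mFourier, fourier_apply, AddCircle.toCircle_add, Finset.prod_mul_distrib]

theorem norm_mFourier_apply (n : ι → ℤ) (x : UnitAddTorus ι) : ‖mFourier n x‖ = 1 := by
  simp only [mFourier, fourier_apply, ContinuousMap.coe_mk, norm_prod, Circle.norm_coe,
    Finset.prod_const_one]

theorem mFourier_apply_zero (n : ι → ℤ) : mFourier n (0 : UnitAddTorus ι) = 1 := by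
  simp [mFourier]

theorem exists_mFourier_eq_neg_one {n : ι → ℤ} (hn : n ≠ 0) :
    ∃ y : UnitAddTorus ι, mFourier n y = -1 := by
  classical
  obtain ⟨i, hi⟩ := Function.ne_iff.1 hn
  refine ⟨Pi.single i ((1 / 2 / (n i : ℝ) : ℝ) : AddCircle (1 : ℝ)), ?_⟩
  change ∏ j, fourier (n j) _ = (-1 : ℂ)
  rw [Finset.prod_eq_single i]
  · simpa using fourier_add_half_inv_index (T := 1) hi one_pos 0
  · intro j _ hj
    simp [hj]
  · simp

end UnitAddTorus

open UnitAddTorus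

theorem integral_mFourier_eq_zero {d : ℕ} {n : Fin d → ℤ} (hn : n ≠ 0) :
    ∫ x : Td d, mFourier n x = 0 := by
  obtain ⟨y, hy⟩ := exists_mFourier_eq_neg_one hn
  refine integral_eq_zero_of_add_right_eq_neg (g := y) fun x => ?_
  rw [mFourier_apply_add, hy, mul_neg_one]

theorem integral_mFourier_convPow {d : ℕ} (μ : Measure (Td d)) [IsProbabilityMeasure μ]
    (n : Fin d → ℤ) (j : ℕ) :
    ∫ x, mFourier n x ∂(convPow μ j) = (∫ x, mFourier n x ∂μ) ^ j := by
  induction j with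
  | zero => simp [convPow, mFourier_apply_zero]
  | succ j ih =>
    have hint : Integrable (fun x => mFourier n x) (μ.conv (convPow μ j)) :=
      (mFourier n).continuous.integrable_of_hasCompactSupport
        (HasCompactSupport.of_compactSpace _)
    rw [convPow, integral_conv hint]
    simp only [mFourier_apply_add, integral_const_mul, integral_mul_const, ih, pow_succ']

/-- A nontrivial character whose mean against `μ` is one would be a nonconstant invariant
function of the skew product. -/
theorem integral_mFourier_ne_one {d : ℕ}
    (μ : Measure (Td d)) [IsProbabilityMeasure μ]
    (μN : Measure (ℕ → Td d)) (hμN : IsBernoulli μ μN)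
    (herg : Ergodic
      (fun p : (ℕ → Td d) × Td d => (fun n => p.1 (n + 1), p.2 + p.1 0))
      (μN.prod volume)) {n : Fin d → ℤ} (hn : n ≠ 0) :
    ∫ x, mFourier n x ∂μ ≠ 1 := by
  intro h1
  have := hμN.1
  have hae : ∀ᵐ x ∂μ, mFourier n x = 1 := by
    rcases ae_eq_const_or_norm_integral_lt_of_norm_le_const (μ := μ) (f := mFourier n) (C := 1)
      (.of_forall fun x => (norm_mFourier_apply n x).le) with h | h
    · simpa [average_eq_integral, h1, Filter.EventuallyEq] using h
    · simp [h1] at h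
  have hmeas : MeasurableSet {x : Td d | mFourier n x = 1} :=
    (isClosed_eq (mFourier n).continuous continuous_const).measurableSet
  have haeN : ∀ᵐ ω ∂μN, mFourier n (ω 0) = 1 := by
    have h := hμN.2 {0} (fun _ => {x | mFourier n x = 1}ᶜ) fun _ => hmeas.compl
    simp only [Finset.mem_singleton, forall_eq, Finset.prod_singleton] at h
    exact h.trans hae
  have hinv : ∀ᵐ p ∂(μN.prod (volume : Measure (Td d))), mFourier n (p.1 0) = 1 :=
    Measure.quasiMeasurePreserving_fst.ae haeN
  obtain ⟨c, hc⟩ := herg.ae_eq_const_of_ae_eq_comp_ae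
    (g := fun p : (ℕ → Td d) × Td d => mFourier n p.2)
    (((mFourier n).continuous.measurable.comp measurable_snd).aestronglyMeasurable) (by
      filter_upwards [hinv] with p hp
      simp [mFourier_apply_add, hp])
  have hc0 : c = 0 := by
    have h := integral_congr_ae hc
    rw [integral_fun_snd (fun x => mFourier n x), integral_mFourier_eq_zero hn] at h
    simpa using h.symm
  obtain ⟨p, hp⟩ := hc.exists
  have h := norm_mFourier_apply n p.2
  simp_all

/-- If the one-sided skew-product `f(β, θ) = (σβ, θ + β₀)` on
`(𝕋^d)^ℕ × 𝕋^d` is ergodic w.r.t. `μ^ℕ × m`, then for every `θ ∈ 𝕋^d` and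
every continuous `φ : 𝕋^d → ℝ`, the Cesàro averages
`(1/n) ∑_{j<n} (Q_μ^j φ)(θ)` converge to `∫ φ dm`. -/
theorem cesaro_markov_tendsto_of_ergodic {d : ℕ}
    (μ : Measure (Td d)) [IsProbabilityMeasure μ]
    (μN : Measure (ℕ → Td d)) (hμN : IsBernoulli μ μN)
    (herg : Ergodic
      (fun p : (ℕ → Td d) × Td d => (fun n => p.1 (n + 1), p.2 + p.1 0))
      (μN.prod volume)) :
    ∀ θ : Td d, ∀ φ : Td d → ℝ, Continuous φ →
      Tendsto (fun n : ℕ => (1 / (n : ℝ)) * ∑ j ∈ Finset.range n, (Qop μ)^[j] φ θ)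
        atTop (𝓝 (∫ θ', φ θ' ∂(volume : Measure (Td d)))) := by
  intro θ φ hφ
  let κ : ℕ → Measure (Td d) := fun j => (convPow μ j).map (θ + ·)
  have hκ (j : ℕ) : IsProbabilityMeasure (κ j) :=
    Measure.isProbabilityMeasure_map (by fun_prop)
  let L : ℕ → C(Td d, ℂ) →ₗ[ℂ] ℂ := fun n =>
    (1 / (n : ℂ)) • ∑ j ∈ Finset.range n, integralFunctional (κ j)
      - if n = 0 then 0 else integralFunctional volume
  have hLapply {n : ℕ} (hn : n ≠ 0) (F : C(Td d, ℂ)) :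
      L n F = (1 / (n : ℂ)) * ∑ j ∈ Finset.range n, ∫ β, F (θ + β) ∂(convPow μ j)
        - ∫ x, F x := by
    have h (j : ℕ) : ∫ x, F x ∂(κ j) = ∫ β, F (θ + β) ∂(convPow μ j) :=
      integral_map (by fun_prop) F.continuous.aestronglyMeasurable
    simp [L, hn, integralFunctional, h]
  have hL (n : ℕ) (F : C(Td d, ℂ)) : ‖L n F‖ ≤ 2 * ‖F‖ := by
    rcases eq_or_ne n 0 with rfl | hn
    · simp [L]
    have hsum : ‖∑ j ∈ Finset.range n, integralFunctional (κ j) F‖ ≤ n * ‖F‖ := by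
      simpa using norm_sum_le_of_le (Finset.range n)
        fun j _ => norm_integralFunctional_le (κ j) F
    have hn' : (0 : ℝ) < n := by positivity
    calc ‖L n F‖ = ‖(1 / (n : ℂ)) * ∑ j ∈ Finset.range n, integralFunctional (κ j) F
          - integralFunctional volume F‖ := by simp [L, hn]
      _ ≤ ‖(1 / (n : ℂ)) * ∑ j ∈ Finset.range n, integralFunctional (κ j) F‖
          + ‖integralFunctional volume F‖ := norm_sub_le _ _
      _ ≤ 1 / n * (n * ‖F‖) + ‖F‖ := by
        rw [norm_mul, norm_div, norm_one, Complex.norm_natCast]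
        gcongr
        exact norm_integralFunctional_le _ F
      _ = 2 * ‖F‖ := by field_simp; ring
  have hchar : ∀ F ∈ Set.range (mFourier (d := Fin d)),
      Tendsto (fun n => L n F) atTop (𝓝 0) := by
    rintro _ ⟨k, rfl⟩
    have hLk : ∀ᶠ n : ℕ in atTop, L n (mFourier k) = mFourier k θ *
        ((1 / (n : ℂ)) * ∑ j ∈ Finset.range n, (∫ x, mFourier k x ∂μ) ^ j)
          - ∫ x : Td d, mFourier k x := by
      filter_upwards [eventually_ne_atTop 0] with n hn
      rw [hLapply hn]
      simp only [mFourier_apply_add, integral_const_mul, integral_mFourier_convPow,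
        ← Finset.mul_sum]
      ring
    rcases eq_or_ne k 0 with rfl | hk
    · refine tendsto_const_nhds.congr' ?_
      filter_upwards [hLk, eventually_ne_atTop 0] with n h hn
      rw [h]
      simp [mFourier_zero, hn]
    · refine Tendsto.congr' (hLk.mono fun n h => h.symm) ?_
      rw [integral_mFourier_eq_zero hk]
      have hnorm : ‖∫ x, mFourier k x ∂μ‖ ≤ 1 :=
        (norm_integralFunctional_le μ (mFourier k)).trans mFourier_norm.le
      simpa using (tendsto_cesaro_pow_zero hnorm
        (integral_mFourier_ne_one μ μN hμN herg hk)).const_mul (mFourier k θ)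
  have hlim := tendsto_zero_of_dense_span L 2 hL _ span_mFourier_closure_eq_top hchar
    ⟨fun x => (φ x : ℂ), by fun_prop⟩
  rw [← tendsto_sub_nhds_zero_iff]
  have hre := (Complex.continuous_re.tendsto 0).comp hlim
  refine hre.congr' ?_
  filter_upwards [eventually_ne_atTop 0] with n hn
  simp only [Function.comp_apply, hLapply hn, ContinuousMap.coe_mk, integral_complex_ofReal,
    Qop_iterate_eq μ φ hφ]
  rw [← Complex.ofReal_re (_ - _)]
  push_cast
  rfl
end
end

section
/- Let μ be a Borel probability measure on 𝕋^d. If the skew-product f(β, θ) = (σβ, θ + β₀) on (𝕋^d)^ℤ × 𝕋^d is ergodic with respect to μ^ℤ × m, then for every continuous φ : 𝕋^d → ℝ, the Cesàro averages (1/n) ∑_{j=0}^{n−1} (Q_μ^j φ)(θ) converge to ∫_{𝕋^d} φ dm uniformly in θ ∈ 𝕋^d. -/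
open MeasureTheory Filter Topology

noncomputable section

open UnitAddTorus in
lemma mFourier_apply_add {d : ℕ} (k : Fin d → ℤ) (x y : Td d) :
    mFourier k (x + y) = mFourier k x * mFourier k y := by
  simp [mFourier, fourier_apply, smul_add, AddCircle.toCircle_add, Finset.prod_mul_distrib]

lemma norm_mFourier_apply {d : ℕ} (k : Fin d → ℤ) (x : Td d) :
    ‖UnitAddTorus.mFourier k x‖ = 1 := by
  simp only [UnitAddTorus.mFourier, fourier_apply, ContinuousMap.coe_mk, norm_prod,
    Circle.norm_coe, Finset.prod_const_one]

/-- For `k ≠ 0` some translation of the torus flips the sign of the character `mFourier k`. -/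
lemma exists_mFourier_eq_neg_one {d : ℕ} {k : Fin d → ℤ} (hk : k ≠ 0) :
    ∃ t : Td d, UnitAddTorus.mFourier k t = -1 := by
  obtain ⟨i, hi⟩ := Function.ne_iff.1 hk
  let t : Td d := Pi.single i ((1 / 2 / k i : ℝ) : AddCircle (1 : ℝ))
  refine ⟨t, ?_⟩
  have h := fourier_add_half_inv_index (T := 1) hi one_pos 0
  rw [zero_add, fourier_eval_zero] at h
  change ∏ j, fourier (k j) (t j) = -1
  rw [Finset.prod_eq_single i, show t i = _ from Pi.single_eq_same i _, h]
  · intro j _ hj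
    rw [show t j = 0 from Pi.single_eq_of_ne hj _, fourier_eval_zero]
  · simp

lemma integral_mFourier_eq_zero_s12 {d : ℕ} {k : Fin d → ℤ} (hk : k ≠ 0) :
    ∫ θ : Td d, UnitAddTorus.mFourier k θ = 0 := by
  obtain ⟨t, ht⟩ := exists_mFourier_eq_neg_one hk
  have h := integral_add_right_eq_self (μ := (volume : Measure (Td d)))
    (fun θ => UnitAddTorus.mFourier k θ) t
  simp only [mFourier_apply_add, ht, mul_neg, mul_one, integral_neg] at h
  exact self_eq_neg.1 h.symm

lemma ContinuousMap.integrable_of_isFiniteMeasure {d : ℕ} (ν : Measure (Td d)) [IsFiniteMeasure ν]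
    (φ : C(Td d, ℂ)) : Integrable φ ν :=
  φ.continuous.integrable_of_hasCompactSupport (HasCompactSupport.of_compactSpace _)

/-- Convolution with `ν`, the Markov operator acting on complex continuous functions. -/
def markovLM {d : ℕ} (ν : Measure (Td d)) [IsProbabilityMeasure ν] :
    C(Td d, ℂ) →ₗ[ℂ] C(Td d, ℂ) where
  toFun φ := ⟨fun θ => ∫ α, φ (θ + α) ∂ν, by
    simpa using continuous_parametric_integral_of_continuous (μ := ν)
      (f := fun θ α => φ (θ + α)) (by fun_prop) isCompact_univ⟩
  map_add' φ ψ := by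
    ext θ
    exact integral_add
      ((φ.comp (ContinuousMap.addLeft θ)).integrable_of_isFiniteMeasure ν)
      ((ψ.comp (ContinuousMap.addLeft θ)).integrable_of_isFiniteMeasure ν)
  map_smul' c φ := by
    ext θ
    exact integral_smul c _

lemma markovLM_apply {d : ℕ} (ν : Measure (Td d)) [IsProbabilityMeasure ν]
    (φ : C(Td d, ℂ)) (θ : Td d) : markovLM ν φ θ = ∫ α, φ (θ + α) ∂ν := rfl

lemma norm_markovLM_le {d : ℕ} (ν : Measure (Td d)) [IsProbabilityMeasure ν]
    (φ : C(Td d, ℂ)) : ‖markovLM ν φ‖ ≤ ‖φ‖ := by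
  refine (ContinuousMap.norm_le _ (norm_nonneg _)).2 fun θ => ?_
  simpa [markovLM_apply] using norm_integral_le_of_norm_le_const (μ := ν)
    (Eventually.of_forall fun α => φ.norm_coe_le_norm (θ + α))

lemma lipschitzWith_markovLM {d : ℕ} (ν : Measure (Td d)) [IsProbabilityMeasure ν] :
    LipschitzWith 1 (markovLM ν) :=
  LipschitzWith.of_dist_le_mul fun φ ψ => by
    simpa [dist_eq_norm] using norm_markovLM_le ν (φ - ψ)

lemma markovLM_mFourier {d : ℕ} (ν : Measure (Td d)) [IsProbabilityMeasure ν] (k : Fin d → ℤ) :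
    markovLM ν (UnitAddTorus.mFourier k)
      = (∫ α, UnitAddTorus.mFourier k α ∂ν) • UnitAddTorus.mFourier k := by
  ext θ
  simp [markovLM_apply, mFourier_apply_add, integral_const_mul, mul_comm]

lemma markovLM_iterate_ofReal {d : ℕ} (μ : Measure (Td d)) [IsProbabilityMeasure μ]
    (φ : Td d → ℝ) (ψ : C(Td d, ℂ)) (h : ∀ θ, ψ θ = φ θ) (j : ℕ) (θ : Td d) :
    (markovLM μ)^[j] ψ θ = ((Qop μ)^[j] φ θ : ℝ) := by
  induction j generalizing θ with
  | zero => exact h θ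
  | succ j ih =>
    rw [Function.iterate_succ_apply', Function.iterate_succ_apply', markovLM_apply]
    simp only [ih, Qop, integral_complex_ofReal]

/-- A unimodular function whose mean is `1` equals `1` almost everywhere. -/
lemma ae_eq_one_of_integral_eq_one {X : Type*} [MeasurableSpace X] {μ : Measure X}
    [IsProbabilityMeasure μ] {f : X → ℂ} (hf : Integrable f μ) (hnorm : ∀ x, ‖f x‖ = 1)
    (h : ∫ x, f x ∂μ = 1) : ∀ᵐ x ∂μ, f x = 1 := by
  have hre : ∫ x, (1 - (f x).re) ∂μ = 0 := by
    have h1 : ∫ x, (f x).re ∂μ = 1 := by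
      have := integral_re hf
      simp only [RCLike.re_to_complex] at this
      rw [this, h, Complex.one_re]
    have h2 := integral_sub (integrable_const (1 : ℝ)) hf.re
    simp only [RCLike.re_to_complex, h1] at h2
    simpa using h2
  have hle : ∀ x, (f x).re ≤ 1 := fun x => (Complex.re_le_norm _).trans (hnorm x).le
  rw [integral_eq_zero_iff_of_nonneg (fun x => sub_nonneg.2 (hle x))
    ((integrable_const _).sub hf.re)] at hre
  filter_upwards [hre] with x hx
  have hx1 : (f x).re = 1 := (sub_eq_zero.1 hx).symm
  have hx2 := Complex.sq_norm (f x)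
  rw [hnorm, Complex.normSq_apply, hx1] at hx2
  exact Complex.ext hx1 (by simpa using hx2)

lemma IsBernoulli.map_eval {Ω ι : Type*} [MeasurableSpace Ω] {ν : Measure Ω}
    {P : Measure (ι → Ω)} (h : IsBernoulli ν P) (i : ι) : P.map (fun ω => ω i) = ν := by
  ext s hs
  rw [Measure.map_apply (measurable_pi_apply i) hs]
  simpa [Set.preimage] using h.2 {i} (fun _ => s) fun _ => hs

/-- Ergodicity of the skew product forces the nontrivial Fourier coefficients of `μ` to differ
from `1`. -/
lemma integral_mFourier_ne_one_of_ergodic {d : ℕ}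
    {μ : Measure (Td d)} [IsProbabilityMeasure μ]
    {μZ : Measure (ℤ → Td d)} (hμZ : IsBernoulli μ μZ)
    (herg : Ergodic
      (fun p : (ℤ → Td d) × Td d => (fun n => p.1 (n + 1), p.2 + p.1 0))
      (μZ.prod volume)) {k : Fin d → ℤ} (hk : k ≠ 0) :
    ∫ α, UnitAddTorus.mFourier k α ∂μ ≠ 1 := by
  intro h
  have := hμZ.1
  have hμ : ∀ᵐ α ∂μ, UnitAddTorus.mFourier k α = 1 :=
    ae_eq_one_of_integral_eq_one (ContinuousMap.integrable_of_isFiniteMeasure μ _)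
      (norm_mFourier_apply k) h
  have hZ : ∀ᵐ β ∂μZ, UnitAddTorus.mFourier k (β 0) = 1 := by
    rw [← hμZ.map_eval 0] at hμ
    exact ae_of_ae_map (measurable_pi_apply 0).aemeasurable hμ
  have hinv : ∀ᵐ p ∂(μZ.prod (volume : Measure (Td d))),
      UnitAddTorus.mFourier k (p.1 0) = 1 :=
    Measure.quasiMeasurePreserving_fst.ae hZ
  have hmeas : AEStronglyMeasurable
      (fun p : (ℤ → Td d) × Td d => UnitAddTorus.mFourier k p.2) (μZ.prod volume) :=
    ((UnitAddTorus.mFourier k).continuous.measurable.comp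
      measurable_snd).aestronglyMeasurable
  obtain ⟨c, hc⟩ := herg.ae_eq_const_of_ae_eq_comp_ae hmeas (by
    filter_upwards [hinv] with p hp
    simp [mFourier_apply_add, hp])
  have hint : ∫ p, UnitAddTorus.mFourier k p.2 ∂(μZ.prod (volume : Measure (Td d))) = 0 := by
    rw [integral_fun_snd (fun θ => UnitAddTorus.mFourier k θ), integral_mFourier_eq_zero_s12 hk,
      smul_zero]
  rw [integral_congr_ae hc] at hint
  simp only [Function.const_apply, integral_const, probReal_univ, one_smul] at hint
  obtain ⟨p, hp⟩ := hc.exists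
  have := norm_mFourier_apply k p.2
  simp [hp, hint] at this

/-- Birkhoff averages of a nonexpanding linear map vanish along an eigenvector whose
eigenvalue is not `1`. -/
lemma tendsto_birkhoffAverage_eigenvector {E : Type*} [NormedAddCommGroup E] [NormedSpace ℂ E]
    {f : E →ₗ[ℂ] E} (hf : ∀ x, ‖f x‖ ≤ ‖x‖) {x : E} {c : ℂ} (hx : f x = c • x) (hc : c ≠ 1) :
    Tendsto (birkhoffAverage ℂ f id · x) atTop (𝓝 0) := by
  have hb : Bornology.IsBounded (Set.range (id <| f^[·] x)) := by
    refine isBounded_iff_forall_norm_le.2 ⟨‖x‖, Set.forall_mem_range.2 fun n => ?_⟩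
    induction n with
    | zero => exact le_rfl
    | succ n ih =>
      simp only [id, Function.iterate_succ_apply'] at ih ⊢
      exact (hf _).trans ih
  have h := tendsto_birkhoffAverage_apply_sub_birkhoffAverage (𝕜 := ℂ) (f := f) (g := id) hb
  have hs : ∀ n, birkhoffAverage ℂ f id n (f x) = c • birkhoffAverage ℂ f id n x := by
    intro n
    simp only [birkhoffAverage, birkhoffSum, id, hx, ← Module.End.pow_apply, map_smul,
      ← Finset.smul_sum]
    exact smul_comm _ _ _
  have hc' : c - 1 ≠ 0 := sub_ne_zero.2 hc
  have h2 := h.const_smul (c - 1)⁻¹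
  rw [smul_zero] at h2
  refine h2.congr fun n => ?_
  rw [hs, inv_smul_eq_iff₀ hc', sub_smul, one_smul]

lemma tendsto_birkhoffAverage_markovLM {d : ℕ} {μ : Measure (Td d)} [IsProbabilityMeasure μ]
    (hμ : ∀ k : Fin d → ℤ, k ≠ 0 → ∫ α, UnitAddTorus.mFourier k α ∂μ ≠ 1) (ψ : C(Td d, ℂ)) :
    Tendsto (birkhoffAverage ℂ (markovLM μ) id · ψ) atTop (𝓝 (markovLM volume ψ)) := by
  have hclosed := isClosed_setOfPred_tendsto_birkhoffAverage ℂ (lipschitzWith_markovLM μ)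
    uniformContinuous_id (lipschitzWith_markovLM (volume : Measure (Td d))).continuous
  have hmem : ψ ∈ closure (Submodule.span ℂ
      (Set.range (UnitAddTorus.mFourier (d := Fin d))) : Set C(Td d, ℂ)) := by
    rw [← Submodule.topologicalClosure_coe, UnitAddTorus.span_mFourier_closure_eq_top]
    trivial
  refine closure_minimal (fun x hx => ?_) hclosed hmem
  induction hx using Submodule.span_induction with
  | mem x hx =>
    obtain ⟨k, rfl⟩ := hx
    obtain rfl | hk := eq_or_ne k 0
    · have hfix (ν : Measure (Td d)) [IsProbabilityMeasure ν] :
          Function.IsFixedPt (markovLM ν) (UnitAddTorus.mFourier 0) := by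
        rw [Function.IsFixedPt, markovLM_mFourier]
        simp [UnitAddTorus.mFourier_zero]
      rw [Set.mem_ofPred_eq, hfix volume]
      exact (hfix μ).tendsto_birkhoffAverage ℂ id
    · have hzero : markovLM (volume : Measure (Td d)) (UnitAddTorus.mFourier k) = 0 := by
        ext θ
        simp [markovLM_apply, mFourier_apply_add, integral_const_mul,
          integral_mFourier_eq_zero_s12 hk]
      rw [Set.mem_ofPred_eq, hzero]
      exact tendsto_birkhoffAverage_eigenvector (norm_markovLM_le μ) (markovLM_mFourier μ k)
        (hμ k hk)
  | zero =>
    have hfix : Function.IsFixedPt (markovLM μ) 0 := map_zero _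
    simpa using hfix.tendsto_birkhoffAverage ℂ id
  | add x y _ _ hx hy =>
    simpa [birkhoffAverage, birkhoffSum, ← Module.End.pow_apply, Finset.sum_add_distrib]
      using hx.add hy
  | smul c x _ hx =>
    simpa [birkhoffAverage, birkhoffSum, ← Module.End.pow_apply, ← Finset.smul_sum,
      smul_comm c] using hx.const_smul c

/-- If the two-sided skew-product `f(β, θ) = (σβ, θ + β₀)` on
`(𝕋^d)^ℤ × 𝕋^d` is ergodic w.r.t. `μ^ℤ × m`, then for every continuous
`φ : 𝕋^d → ℝ` the Cesàro averages `(1/n) ∑_{j<n} (Q_μ^j φ)(θ)` converge to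
`∫ φ dm` uniformly in `θ ∈ 𝕋^d`. -/
theorem cesaro_markov_tendstoUniformly_of_ergodic {d : ℕ}
    (μ : Measure (Td d)) [IsProbabilityMeasure μ]
    (μZ : Measure (ℤ → Td d)) (hμZ : IsBernoulli μ μZ)
    (herg : Ergodic
      (fun p : (ℤ → Td d) × Td d => (fun n => p.1 (n + 1), p.2 + p.1 0))
      (μZ.prod volume)) :
    ∀ φ : Td d → ℝ, Continuous φ →
      TendstoUniformly
        (fun (n : ℕ) (θ : Td d) =>
          (1 / (n : ℝ)) * ∑ j ∈ Finset.range n, (Qop μ)^[j] φ θ)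
        (fun _ => ∫ θ', φ θ' ∂(volume : Measure (Td d))) atTop := by
  intro φ hφ
  let ψ : C(Td d, ℂ) := ⟨fun θ => (φ θ : ℂ), by fun_prop⟩
  have h := tendsto_birkhoffAverage_markovLM
    (fun k hk => integral_mFourier_ne_one_of_ergodic hμZ herg hk) ψ
  rw [ContinuousMap.tendsto_iff_tendstoUniformly, Metric.tendstoUniformly_iff] at h
  rw [Metric.tendstoUniformly_iff]
  intro ε hε
  filter_upwards [h ε hε] with n hn θ
  have hn := hn θ
  have hl : markovLM volume ψ θ = ((∫ θ', φ θ' : ℝ) : ℂ) := by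
    rw [markovLM_apply, integral_add_left_eq_self (fun α => ψ α) θ]
    exact integral_complex_ofReal
  have ha : birkhoffAverage ℂ (markovLM μ) id n ψ θ
      = ((1 / (n : ℝ) * ∑ j ∈ Finset.range n, (Qop μ)^[j] φ θ : ℝ) : ℂ) := by
    simp [birkhoffAverage, birkhoffSum,
      markovLM_iterate_ofReal μ φ ψ (fun _ => rfl)]
  rwa [hl, ha, Complex.dist_eq, ← Complex.ofReal_sub, Complex.norm_real,
    ← dist_eq_norm] at hn
end
end

section
/- Let Ω be a Polish space, ν a compactly supported Borel probability measure on Ω, 𝔞 : Ω → 𝕋^d continuous, X = Ω^ℤ, and f : X × 𝕋^d → X × 𝕋^d, f(ω, θ) = (σω, θ + 𝔞(ω₀)). Assume f is ergodic with respect to ν^ℤ × m. Then there is a set X' ⊂ X with ν^ℤ(X') = 1 such that for every bounded continuous observable φ : X × 𝕋^d → ℝ and every ω ∈ X', the Birkhoff averages (1/n) ∑_{j=0}^{n−1} φ(f^j(ω, θ)) converge to ∫ φ d(ν^ℤ × m) as n → ∞, uniformly in θ ∈ 𝕋^d. -/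
open MeasureTheory Filter Topology

noncomputable section

/-- If `f` is ergodic and `φ` is bounded with negative integral, then almost surely the Birkhoff sums
of `φ` are bounded above. -/
lemma ae_bddAbove_birkhoffSum_of_integral_neg {α : Type*} [MeasurableSpace α] {μ : Measure α}
    [IsProbabilityMeasure μ] {f : α → α} (hf : Ergodic f μ) {φ : α → ℝ} (hφ : Measurable φ)
    {C : ℝ} (hC : ∀ x, |φ x| ≤ C) (hneg : ∫ x, φ x ∂μ < 0) :
    ∀ᵐ x ∂μ, BddAbove (Set.range fun n => birkhoffSum f φ n x) := by
  have hfm : Measurable f := hf.measurable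
  have hSm : ∀ n, Measurable fun x => birkhoffSum f φ n x := fun n => by
    unfold birkhoffSum
    exact Finset.measurable_sum _ fun k _ => hφ.comp (hfm.iterate k)
  obtain ⟨M, hM0, hMs⟩ : ∃ M : ℕ → α → ℝ, (∀ x, M 0 x = 0) ∧
      ∀ n x, M (n + 1) x = max 0 (φ x + M n (f x)) :=
    ⟨fun n => Nat.rec (fun _ => 0) (fun _ g x => max 0 (φ x + g (f x))) n,
      fun _ => rfl, fun _ _ => rfl⟩
  have hMm : ∀ n, Measurable (M n) := by
    intro n
    induction n with
    | zero => exact (funext hM0 : M 0 = fun _ => 0) ▸ measurable_const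
    | succ n ih =>
      rw [funext (hMs n)]
      exact measurable_const.max (hφ.add (ih.comp hfm))
  have hMnn : ∀ n x, 0 ≤ M n x := by
    intro n x
    cases n with
    | zero => exact (hM0 x).ge
    | succ n => exact (hMs n x).symm ▸ le_max_left _ _
  have hMle : ∀ n x, M n x ≤ n * C := by
    intro n
    induction n with
    | zero => intro x; simp [hM0]
    | succ n ih =>
      intro x
      have h1 := hC x
      have h2 := ih (f x)
      have h3 := abs_le.1 h1
      have h4 := hMnn n (f x)
      rw [hMs]
      push_cast
      refine max_le ?_ ?_
      · have := (abs_nonneg _).trans h1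
        positivity
      · linarith
  have hMmono : ∀ n x, M n x ≤ M (n + 1) x := by
    intro n
    induction n with
    | zero => exact fun x => (hM0 x).trans_le (hMnn 1 x)
    | succ n ih =>
      intro x
      rw [hMs, hMs (n + 1)]
      exact max_le_max le_rfl (by linarith [ih (f x)])
  have hSM : ∀ n x, birkhoffSum f φ n x ≤ M n x := by
    intro n
    induction n with
    | zero => intro x; simp [hM0]
    | succ n ih =>
      intro x
      rw [birkhoffSum_succ', hMs]
      exact le_max_of_le_right (by linarith [ih (f x)])
  have hMint : ∀ n, Integrable (M n) μ := fun n =>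
    Integrable.of_bound (hMm n).aestronglyMeasurable (n * C) (ae_of_all _ fun x => by
      rw [Real.norm_of_nonneg (hMnn n x)]; exact hMle n x)
  set A : Set α := {x | BddAbove (Set.range fun n => birkhoffSum f φ n x)} with hA
  have hAm : MeasurableSet A := measurableSet_bddAbove_range hSm
  have hAinv : f ⁻¹' A = A := by
    ext x
    simp only [hA, Set.mem_preimage, Set.mem_ofPred_eq]
    constructor
    · rintro ⟨B, hB⟩
      refine ⟨max 0 (φ x + B), ?_⟩
      rintro _ ⟨n, rfl⟩
      cases n with
      | zero => simp
      | succ n =>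
        simp only [birkhoffSum_succ']
        exact le_max_of_le_right (by linarith [hB ⟨n, rfl⟩])
    · rintro ⟨B, hB⟩
      refine ⟨B - φ x, ?_⟩
      rintro _ ⟨n, rfl⟩
      have := hB ⟨n + 1, rfl⟩
      simp only [birkhoffSum_succ'] at this
      linarith
  rcases hf.toPreErgodic.ae_empty_or_univ hAm hAinv with h | h
  · exfalso
    have hunb : ∀ᵐ x ∂μ, x ∉ A := by
      filter_upwards [h] with x hx hxA
      exact (hx.mp hxA : x ∈ (∅ : Set α))
    have hnn : ∀ n, 0 ≤ ∫ x, (M (n + 1) x - M n (f x)) ∂μ := by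
      intro n
      have h1 : Integrable (fun x => M n (f x)) μ :=
        hf.toMeasurePreserving.integrable_comp_of_integrable (hMint n)
      have h2 : ∫ x, M n (f x) ∂μ = ∫ x, M n x ∂μ := by
        have := integral_map (μ := μ) hfm.aemeasurable (f := M n)
          (hMm n).aestronglyMeasurable
        rw [hf.toMeasurePreserving.map_eq] at this
        exact this.symm
      rw [integral_sub (hMint _) h1, h2, sub_nonneg]
      exact integral_mono (hMint _) (hMint _) (hMmono n)
    have hlim : Tendsto (fun n => ∫ x, (M (n + 1) x - M n (f x)) ∂μ) atTop
        (𝓝 (∫ x, φ x ∂μ)) := by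
      refine tendsto_integral_of_dominated_convergence (fun _ => C)
        (fun n => ((hMm (n + 1)).sub ((hMm n).comp hfm)).aestronglyMeasurable)
        (integrable_const _) (fun n => ae_of_all _ fun x => ?_) ?_
      · have h1 := abs_le.1 (hC x)
        have h2 := hMnn n (f x)
        rw [Real.norm_eq_abs, hMs, abs_le]
        constructor
        · linarith [le_max_right 0 (φ x + M n (f x))]
        · rw [sub_le_iff_le_add]
          exact max_le (by linarith) (by linarith)
      · filter_upwards [hunb] with x hx
        have hx' : f x ∉ A := fun hc => hx (by rw [← hAinv]; exact hc)
        obtain ⟨N, hN⟩ : ∃ N, |φ x| < birkhoffSum f φ N (f x) := by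
          by_contra! hcon
          exact hx' ⟨|φ x|, by rintro _ ⟨n, rfl⟩; exact hcon n⟩
        refine tendsto_const_nhds.congr' ?_
        filter_upwards [eventually_ge_atTop N] with n hn
        have h1 : M N (f x) ≤ M n (f x) :=
          monotone_nat_of_le_succ (f := fun n => M n (f x)) (fun n => hMmono n _) hn
        have h2 := hSM N (f x)
        have h3 := neg_abs_le (φ x)
        rw [hMs, max_eq_right (by linarith)]
        ring
    exact absurd (ge_of_tendsto' hlim hnn) (not_le.2 hneg)
  · filter_upwards [h] with x hx
    exact hx.mpr trivial

/-- Birkhoff's pointwise ergodic theorem, for bounded measurable observables of an ergodic map. -/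
lemma Ergodic.ae_tendsto_birkhoffAverage {α : Type*} [MeasurableSpace α] {μ : Measure α}
    [IsProbabilityMeasure μ] {f : α → α} (hf : Ergodic f μ) {φ : α → ℝ} (hφ : Measurable φ)
    {C : ℝ} (hC : ∀ x, |φ x| ≤ C) :
    ∀ᵐ x ∂μ, Tendsto (fun n => birkhoffAverage ℝ f φ n x) atTop (𝓝 (∫ x, φ x ∂μ)) := by
  have upper : ∀ ψ : α → ℝ, Measurable ψ → (∀ x, |ψ x| ≤ C) → ∀ᵐ x ∂μ, ∀ k : ℕ,
      ∀ᶠ n in atTop, birkhoffAverage ℝ f ψ n x < ∫ x, ψ x ∂μ + 2 / ((k : ℝ) + 1) := by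
    intro ψ hψ hψC
    have hint : Integrable ψ μ :=
      Integrable.of_bound hψ.aestronglyMeasurable C (ae_of_all _ hψC)
    rw [ae_all_iff]
    intro k
    have hk : (0 : ℝ) < 1 / ((k : ℝ) + 1) := by positivity
    set c : ℝ := ∫ x, ψ x ∂μ + 1 / ((k : ℝ) + 1) with hc
    have hneg : ∫ x, (ψ x - c) ∂μ < 0 := by
      rw [integral_sub hint (integrable_const _), integral_const, probReal_univ, one_smul]
      linarith
    have hb : ∀ x, |ψ x - c| ≤ C + |c| := fun x =>
      (abs_sub _ _).trans (by linarith [hψC x])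
    filter_upwards [ae_bddAbove_birkhoffSum_of_integral_neg hf (hψ.sub_const c) hb hneg] with x hx
    obtain ⟨B, hB⟩ := hx
    have hlim : Tendsto (fun n : ℕ => B / (n : ℝ)) atTop (𝓝 0) :=
      tendsto_const_div_atTop_nhds_zero_nat B
    filter_upwards [hlim.eventually (gt_mem_nhds hk), eventually_gt_atTop 0] with n hn hn0
    have hn0' : (0 : ℝ) < n := by exact_mod_cast hn0
    have h1 : birkhoffSum f (fun x => ψ x - c) n x ≤ B := hB ⟨n, rfl⟩
    have h2 : birkhoffSum f (fun x => ψ x - c) n x = birkhoffSum f ψ n x - n * c := by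
      simp [birkhoffSum, Finset.sum_sub_distrib]
    have h3 : birkhoffAverage ℝ f ψ n x = birkhoffSum f ψ n x / n := by
      rw [birkhoffAverage, smul_eq_mul, inv_mul_eq_div]
    have h4 : birkhoffSum f ψ n x / n ≤ B / n + c := by
      rw [div_le_iff₀ hn0', add_mul, div_mul_cancel₀ _ hn0'.ne']
      linarith
    have h5 : 2 / ((k : ℝ) + 1) = 1 / ((k : ℝ) + 1) + 1 / ((k : ℝ) + 1) := by ring
    rw [h3, h5]
    linarith
  filter_upwards [upper φ hφ hC, upper (fun x => -φ x) hφ.neg (by simpa using hC)] with x h1 h2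
  rw [Metric.tendsto_atTop']
  intro ε hε
  obtain ⟨k, hk⟩ := exists_nat_one_div_lt (half_pos hε)
  have hk' : 2 / ((k : ℝ) + 1) < ε := by
    have : 2 / ((k : ℝ) + 1) = 2 * (1 / ((k : ℝ) + 1)) := by ring
    linarith
  obtain ⟨N, hN⟩ := eventually_atTop.1 ((h1 k).and (h2 k))
  refine ⟨N, fun n hn => ?_⟩
  obtain ⟨h3, h4⟩ := hN n hn.le
  have h5 : birkhoffAverage ℝ f (fun x => -φ x) n x = -birkhoffAverage ℝ f φ n x := by
    simp [birkhoffAverage, birkhoffSum]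
  rw [h5, integral_neg] at h4
  rw [Real.dist_eq, abs_lt]
  constructor <;> linarith

lemma abs_birkhoffAverage_sub_le {α : Type*} {f : α → α} {φ ψ : α → ℝ} {S : Set α}
    (hS : Set.MapsTo f S S) {δ : ℝ} (hδ : 0 ≤ δ) (h : ∀ x ∈ S, |φ x - ψ x| ≤ δ) {x : α}
    (hx : x ∈ S) (n : ℕ) :
    |birkhoffAverage ℝ f φ n x - birkhoffAverage ℝ f ψ n x| ≤ δ := by
  rcases n.eq_zero_or_pos with rfl | hn
  · simpa using hδ
  have hn' : (0 : ℝ) < n := by exact_mod_cast hn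
  rw [birkhoffAverage, birkhoffAverage, birkhoffSum, birkhoffSum, ← smul_sub,
    ← Finset.sum_sub_distrib, smul_eq_mul, abs_mul, abs_inv, Nat.abs_cast, inv_mul_le_iff₀ hn']
  refine (Finset.abs_sum_le_sum_abs _ _).trans ?_
  refine (Finset.sum_le_sum fun k _ => h _ (hS.iterate k hx)).trans ?_
  simp

/-- On a closed compact subset of a metrizable space, countably many bounded continuous functions on
the whole space are uniformly dense among the continuous functions. -/
lemma exists_seq_boundedContinuousFunction_dense_on {Z : Type*} [TopologicalSpace Z]
    [T2Space Z] [NormalSpace Z] [SecondCountableTopology Z] {S : Set Z} (hS : IsCompact S) :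
    ∃ g : ℕ → BoundedContinuousFunction Z ℝ, ∀ u : C(S, ℝ), ∀ δ > 0,
      ∃ k, ∀ p : S, |u p - g k p| < δ := by
  have : CompactSpace S := isCompact_iff_compactSpace.1 hS
  have ext : ∀ u : C(S, ℝ), ∃ g : BoundedContinuousFunction Z ℝ, ∀ p : S, g p = u p := by
    intro u
    obtain ⟨g, -, hg⟩ := BoundedContinuousFunction.exists_extension_norm_eq_of_isClosedEmbedding
      (BoundedContinuousFunction.mkOfCompact u) hS.isClosed.isClosedEmbedding_subtypeVal
    exact ⟨g, fun p => congrFun hg p⟩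
  choose e he using ext
  refine ⟨fun k => e (TopologicalSpace.denseSeq C(S, ℝ) k), fun u δ hδ => ?_⟩
  obtain ⟨k, hk⟩ := (TopologicalSpace.denseRange_denseSeq C(S, ℝ)).exists_dist_lt u hδ
  refine ⟨k, fun p => ?_⟩
  rw [he, ← Real.dist_eq]
  exact (ContinuousMap.dist_apply_le_dist p).trans_lt hk

/-- Let `Ω` be Polish, `ν` a compactly supported Borel
probability measure, `𝔞 : Ω → 𝕋^d` continuous and `f(ω, θ) = (σω, θ + 𝔞(ω₀))`
ergodic w.r.t. `ν^ℤ × m`. Then there is a full-measure set `X' ⊆ X = Ω^ℤ` such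
that for every bounded continuous `φ : X × 𝕋^d → ℝ` and every `ω ∈ X'`, the
Birkhoff averages `(1/n) ∑_{j<n} φ(f^j(ω, θ))` converge to `∫ φ d(ν^ℤ × m)`,
uniformly in `θ ∈ 𝕋^d`. -/
theorem birkhoff_uniform_convergence
    {Ω : Type*} [TopologicalSpace Ω] [PolishSpace Ω]
    [MeasurableSpace Ω] [BorelSpace Ω] {d : ℕ}
    (ν : Measure Ω) [IsProbabilityMeasure ν]
    (hν : ∃ K : Set Ω, IsCompact K ∧ ν Kᶜ = 0)
    (𝔞 : Ω → Td d) (h𝔞 : Continuous 𝔞)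
    (νZ : Measure (ℤ → Ω)) (hνZ : IsBernoulli ν νZ)
    (f : ((ℤ → Ω) × Td d) → ((ℤ → Ω) × Td d))
    (hf : f = fun p => (shiftZ Ω p.1, p.2 + 𝔞 (p.1 0)))
    (herg : Ergodic f (νZ.prod volume)) :
    ∃ X' : Set (ℤ → Ω), νZ X' = 1 ∧
      ∀ φ : ((ℤ → Ω) × Td d) → ℝ, Continuous φ → (∃ C : ℝ, ∀ p, |φ p| ≤ C) →
        ∀ ω ∈ X',
          TendstoUniformly
            (fun (n : ℕ) (θ : Td d) =>
              (1 / (n : ℝ)) * ∑ j ∈ Finset.range n, φ (f^[j] (ω, θ)))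
            (fun _ => ∫ p, φ p ∂(νZ.prod volume)) atTop := by
  obtain ⟨hprob, hcyl⟩ := hνZ
  obtain ⟨K, hK, hνK⟩ := hν
  set μ : Measure ((ℤ → Ω) × Td d) := νZ.prod volume with hμ
  set S : Set ((ℤ → Ω) × Td d) := (Set.univ.pi fun _ : ℤ => K) ×ˢ Set.univ with hS
  have hScpt : IsCompact S := (isCompact_univ_pi fun _ => hK).prod isCompact_univ
  have hSmem : ∀ p, p ∈ S ↔ ∀ n, p.1 n ∈ K := fun p => by simp [hS, Set.mem_pi]
  have hmaps : Set.MapsTo f S S := fun p hp => by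
    rw [hSmem] at hp ⊢
    intro n
    simp only [hf, shiftZ]
    exact hp (n + 1)
  have hKae : ∀ᵐ ω ∂νZ, ∀ n, ω n ∈ K := by
    rw [ae_all_iff]
    intro n
    have := hcyl {n} (fun _ => Kᶜ) (fun _ => hK.isClosed.measurableSet.compl)
    simp only [Finset.mem_singleton, forall_eq, Finset.prod_singleton, hνK] at this
    exact this
  have hSae : ∀ᵐ p ∂μ, p ∈ S := by
    have : ∀ᵐ p ∂μ, ∀ n, p.1 n ∈ K :=
      (Measure.quasiMeasurePreserving_fst (μ := νZ) (ν := (volume : Measure (Td d)))).ae hKae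
    filter_upwards [this] with p hp using (hSmem p).2 hp
  obtain ⟨g, hg⟩ := exists_seq_boundedContinuousFunction_dense_on hScpt
  have hgae : ∀ᵐ p ∂μ, ∀ k,
      Tendsto (fun n => birkhoffAverage ℝ f (g k) n p) atTop (𝓝 (∫ p, g k p ∂μ)) := by
    rw [ae_all_iff]
    exact fun k => herg.ae_tendsto_birkhoffAverage (g k).continuous.measurable
      fun x => (g k).norm_coe_le_norm x
  refine ⟨{ω | (∀ n, ω n ∈ K) ∧ ∃ θ : Td d, ∀ k,
      Tendsto (fun n => birkhoffAverage ℝ f (g k) n (ω, θ)) atTop (𝓝 (∫ p, g k p ∂μ))}, ?_, ?_⟩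
  · have : ∀ᵐ ω ∂νZ, (∀ n, ω n ∈ K) ∧ ∃ θ : Td d, ∀ k,
      Tendsto (fun n => birkhoffAverage ℝ f (g k) n (ω, θ)) atTop (𝓝 (∫ p, g k p ∂μ)) := by
      filter_upwards [hKae, Measure.ae_ae_of_ae_prod hgae] with ω h1 h2
      exact ⟨h1, h2.exists⟩
    rw [measure_congr (eventuallyEq_univ.2 this), measure_univ]
  rintro φ hφ ⟨C, hC⟩ ω ⟨hωK, θ₀, hθ₀⟩
  have : CompactSpace S := isCompact_iff_compactSpace.1 hScpt
  have hωS : (ω, θ₀) ∈ S := (hSmem _).2 hωK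
  let R : Td d → (ℤ → Ω) × Td d → (ℤ → Ω) × Td d := fun t p => (p.1, p.2 + t)
  have hR : ∀ t, MeasurePreserving (R t) μ μ := fun t =>
    (MeasurePreserving.id νZ).prod (measurePreserving_add_right volume t)
  have hRcont : ∀ t, Continuous (R t) := fun t => by fun_prop
  have hcomm : ∀ t, Function.Commute (R t) f := fun t p => by
    simp only [R, hf, Prod.mk.injEq, true_and]
    abel
  have hRint : ∀ t, ∫ p, φ (R t p) ∂μ = ∫ p, φ p ∂μ := fun t => by
    have := integral_map (μ := μ) (hR t).aemeasurable (f := φ) hφ.aestronglyMeasurable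
    rw [(hR t).map_eq] at this
    exact this.symm
  have havg : ∀ (n : ℕ) (θ : Td d), (1 / (n : ℝ)) * ∑ j ∈ Finset.range n, φ (f^[j] (ω, θ)) =
      birkhoffAverage ℝ f (φ ∘ R (θ - θ₀)) n (ω, θ₀) := by
    intro n θ
    rw [birkhoffAverage, birkhoffSum, smul_eq_mul, one_div]
    congr 1
    refine Finset.sum_congr rfl fun j _ => ?_
    have h1 := (hcomm (θ - θ₀)).iterate_right j (ω, θ₀)
    have h2 : R (θ - θ₀) (ω, θ₀) = (ω, θ) := by simp [R]
    rw [Function.comp_apply, h1, h2]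
  let Φ : C(Td d, C(S, ℝ)) := ContinuousMap.curry
    ⟨fun q => φ (R (q.1 - θ₀) q.2.1), by fun_prop⟩
  have hΦ : ∀ θ p, Φ θ p = φ (R (θ - θ₀) p.1) := fun _ _ => rfl
  rw [← tendstoLocallyUniformly_iff_tendstoUniformly_of_compactSpace,
    Metric.tendstoLocallyUniformly_iff]
  intro ε hε θ₁
  obtain ⟨k, hk⟩ := hg (Φ θ₁) (ε / 8) (by positivity)
  refine ⟨{θ | dist (Φ θ) (Φ θ₁) < ε / 8},
    (Metric.continuousAt_iff'.1 Φ.continuous.continuousAt) (ε / 8) (by positivity), ?_⟩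
  filter_upwards [Metric.tendsto_nhds.1 (hθ₀ k) (ε / 4) (by positivity)] with n hn θ hθ
  have hclose : ∀ p ∈ S, |(φ ∘ R (θ - θ₀)) p - g k p| ≤ ε / 4 := by
    intro p hp
    have h1 := (ContinuousMap.dist_apply_le_dist (f := Φ θ) (g := Φ θ₁) ⟨p, hp⟩).trans_lt hθ
    have h2 := hk ⟨p, hp⟩
    rw [Real.dist_eq, hΦ θ] at h1
    calc |φ (R (θ - θ₀) p) - g k p| ≤ |φ (R (θ - θ₀) p) - Φ θ₁ ⟨p, hp⟩|
          + |Φ θ₁ ⟨p, hp⟩ - g k p| := abs_sub_le _ _ _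
      _ ≤ ε / 4 := by linarith
  have hA := abs_birkhoffAverage_sub_le hmaps (by positivity) hclose hωS n
  have hI : |∫ p, φ p ∂μ - ∫ p, g k p ∂μ| ≤ ε / 4 := by
    have hφint : Integrable (φ ∘ R (θ - θ₀)) μ :=
      Integrable.of_bound (hφ.comp (hRcont _)).aestronglyMeasurable C
        (ae_of_all _ fun p => hC _)
    have hgint : Integrable (g k) μ :=
      Integrable.of_bound (g k).continuous.aestronglyMeasurable ‖g k‖
        (ae_of_all _ fun p => (g k).norm_coe_le_norm p)
    rw [← hRint (θ - θ₀)]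
    have h1 : ∫ p, φ (R (θ - θ₀) p) ∂μ - ∫ p, g k p ∂μ =
        ∫ p, ((φ ∘ R (θ - θ₀)) p - g k p) ∂μ := (integral_sub hφint hgint).symm
    have h2 := norm_integral_le_of_norm_le_const (μ := μ)
      (f := fun p => (φ ∘ R (θ - θ₀)) p - g k p) (C := ε / 4)
      (by filter_upwards [hSae] with p hp using hclose p hp)
    rw [probReal_univ, mul_one, Real.norm_eq_abs] at h2
    rwa [h1]
  rw [havg, Real.dist_eq]
  rw [Real.dist_eq] at hn
  rw [abs_lt] at hn ⊢
  rw [abs_le] at hA hI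
  constructor <;> linarith [hA.1, hA.2, hI.1, hI.2, hn.1, hn.2]
end
end
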